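/- There exist constants c > 0 and d_0 such that for every d ≥ d_0 and every n sufficiently large relative to d the following holds: if G is a connected graph with n vertices and minimum degree at least d, and 𝒯 is a uniformly random spanning tree of G, then for every tree T we have ℙ(𝒯 ≅ T) ≤ n^{-c·d}. -/

import Mathlib

namespace AntiTree
open Finset
open scoped Classical

/-! ### Counting lemmas -/

lemma card_le_sum_of_fiberwise {α κ : Type*} (Ω E : Finset α) (key : α → κ) (φ : α → ℝ)
    (h : ∀ b ∈ Ω, (#{a ∈ E | key a = key b} : ℝ) ≤ ∑ a ∈ Ω with key a = key b, φ a)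
    (hE : E ⊆ Ω) : (#E : ℝ) ≤ ∑ a ∈ Ω, φ a := by
  rw [← sum_fiberwise_of_maps_to (s := Ω) (t := Ω.image key) (g := key)
    (fun a ha => mem_image_of_mem _ ha),
    card_eq_sum_card_fiberwise (s := E) (t := Ω.image key) (f := key)
    (fun a ha => mem_image_of_mem _ (hE ha))]
  push_cast
  refine sum_le_sum fun k hk => ?_
  obtain ⟨b, hb, rfl⟩ := mem_image.1 hk
  exact h b hb

lemma card_le_mul_of_fiberwise {α κ : Type*} (Ω E : Finset α) (key : α → κ) (β : ℝ)
    (h : ∀ b ∈ Ω, (#{a ∈ E | key a = key b} : ℝ) ≤ β * #{a ∈ Ω | key a = key b})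
    (hE : E ⊆ Ω) : (#E : ℝ) ≤ β * #Ω := by
  have := card_le_sum_of_fiberwise Ω E key (fun _ => β)
    (fun b hb => by simpa [mul_comm] using h b hb) hE
  simpa [mul_comm] using this

lemma choose_half_sq_le (N : ℕ) : (N.choose (N / 2)) ^ 2 * (N + 1) ≤ 4 ^ N := by
  have key : ∀ n : ℕ, n.centralBinom ^ 2 * (2 * n + 1) ≤ 16 ^ n := by
    intro n
    induction n with
    | zero => simp
    | succ n ih =>
      have h := Nat.succ_mul_centralBinom_succ n
      have h2 : (n + 1) ^ 2 * ((n + 1).centralBinom ^ 2 * (2 * (n + 1) + 1))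
          ≤ (n + 1) ^ 2 * 16 ^ (n + 1) := by
        calc (n + 1) ^ 2 * ((n + 1).centralBinom ^ 2 * (2 * (n + 1) + 1))
            = ((n + 1) * (n + 1).centralBinom) ^ 2 * (2 * n + 3) := by ring
          _ = (n.centralBinom ^ 2 * (2 * n + 1)) * (4 * ((2 * n + 1) * (2 * n + 3))) := by
              rw [h]; ring
          _ ≤ 16 ^ n * (4 * (4 * (n + 1) ^ 2)) := by
              refine Nat.mul_le_mul ih (Nat.mul_le_mul_left _ ?_)
              nlinarith
          _ = _ := by ring
      exact Nat.le_of_mul_le_mul_left h2 (by positivity)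
  rcases Nat.even_or_odd' N with ⟨n, rfl | rfl⟩
  · have := key n
    rw [Nat.centralBinom_eq_two_mul_choose] at this
    rw [Nat.mul_div_cancel_left _ (by norm_num), pow_mul]
    exact this
  · have h1 := key (n + 1)
    have h2 : (n + 1).centralBinom = 2 * (2 * n + 1).choose n := by
      have := Nat.succ_mul_centralBinom_succ n
      rw [Nat.centralBinom_eq_two_mul_choose, show 2 * (n + 1) = (2 * n + 1) + 1 by ring,
        Nat.choose_succ_succ, ← Nat.choose_symm_half n]
      ring
    rw [h2] at h1
    rw [show (2 * n + 1) / 2 = n by omega]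
    have e : (16 : ℕ) ^ (n + 1) = 4 * 4 ^ (2 * n + 1) := by
      rw [show (16 : ℕ) = 4 ^ 2 by norm_num, ← pow_mul]; ring
    rw [e] at h1
    nlinarith [sq_nonneg ((2 * n + 1).choose n)]

lemma choose_half_div_le (N m : ℕ) (h : m ≤ N) :
    ((N.choose (N / 2) : ℕ) : ℝ) / 2 ^ N ≤ 1 / √(m + 1) := by
  have h1 : ((N.choose (N / 2) : ℕ) : ℝ) ^ 2 * (N + 1) ≤ 4 ^ N := by
    exact_mod_cast choose_half_sq_le N
  have hm : (m : ℝ) ≤ N := by exact_mod_cast h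
  rw [div_le_div_iff₀ (by positivity) (by positivity), one_mul]
  refine le_of_sq_le_sq ?_ (by positivity)
  rw [mul_pow, Real.sq_sqrt (by positivity), ← pow_mul, mul_comm N, pow_mul]
  norm_num
  refine le_trans ?_ h1
  gcongr

lemma card_few_hits_le {ι : Type*} [Fintype ι] {Ω : ι → Type*} [∀ i, Fintype (Ω i)]
    (I : Finset ι) (P : ∀ i, Finset (Ω i)) (hP : ∀ i ∈ I, (P i).Nonempty) (Q : ℕ)
    (hQ : ∀ i ∈ I, Fintype.card (Ω i) ≤ Q) (m : ℕ) :
    (#{a : ∀ i, Ω i | #{i ∈ I | a i ∈ P i} < m} : ℝ) ≤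
      2 ^ m * (1 - 1 / (2 * Q)) ^ #I * Fintype.card (∀ i, Ω i) := by
  let f : ∀ i, Ω i → ℝ := fun i x => if i ∈ I ∧ x ∈ P i then 1 / 2 else 1
  have hf : ∀ i x, 0 ≤ f i x := by
    intro i x; simp only [f]; split_ifs <;> norm_num
  have hprod : ∀ a : ∀ i, Ω i, ∏ i, f i (a i) = (1 / 2) ^ #{i ∈ I | a i ∈ P i} := by
    intro a
    simp only [f]
    rw [prod_ite, prod_const, prod_const_one, mul_one]
    congr 2
    ext i; simp
  calc (#{a : ∀ i, Ω i | #{i ∈ I | a i ∈ P i} < m} : ℝ)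
      = ∑ a : ∀ i, Ω i with #{i ∈ I | a i ∈ P i} < m, 1 := by simp
    _ ≤ ∑ a : ∀ i, Ω i with #{i ∈ I | a i ∈ P i} < m, 2 ^ m * ∏ i, f i (a i) := by
        refine sum_le_sum fun a ha => ?_
        rw [hprod, one_div, inv_pow, ← div_eq_mul_inv, one_le_div (by positivity)]
        exact pow_le_pow_right₀ (by norm_num) (mem_filter.1 ha).2.le
    _ ≤ ∑ a : ∀ i, Ω i, 2 ^ m * ∏ i, f i (a i) := by
        refine sum_le_sum_of_subset_of_nonneg (filter_subset _ _) fun a _ _ => ?_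
        exact mul_nonneg (by positivity) (prod_nonneg fun i _ => hf i _)
    _ = 2 ^ m * ∏ i, ∑ x, f i x := by
        rw [← mul_sum, Finset.prod_univ_sum, Fintype.piFinset_univ]
    _ ≤ 2 ^ m * ∏ i, ((if i ∈ I then (1 - 1 / (2 * Q) : ℝ) else 1) * Fintype.card (Ω i)) := by
        refine mul_le_mul_of_nonneg_left ?_ (by positivity)
        refine prod_le_prod (fun i _ => sum_nonneg fun x _ => hf i x) fun i _ => ?_
        by_cases hi : i ∈ I
        · have hs : ∑ x, f i x = Fintype.card (Ω i) - (#(P i) : ℝ) / 2 := by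
            have : ∀ x, f i x = 1 - (if x ∈ P i then (1 / 2 : ℝ) else 0) := by
              intro x; simp only [f, hi, true_and]; split_ifs <;> norm_num
            rw [sum_congr rfl fun x _ => this x, sum_sub_distrib]
            simp; ring
          have h1 : (1 : ℝ) ≤ #(P i) := by exact_mod_cast (hP i hi).card_pos
          have h2 : (Fintype.card (Ω i) : ℝ) ≤ Q := by exact_mod_cast hQ i hi
          have h3 : (1 : ℝ) ≤ Fintype.card (Ω i) :=
            h1.trans (by exact_mod_cast card_le_univ (P i))
          rw [hs, if_pos hi, sub_mul, one_mul]
          have : 1 / (2 * (Q : ℝ)) * Fintype.card (Ω i) ≤ 1 / 2 := by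
            rw [one_div, inv_mul_le_iff₀ (by linarith)]; linarith
          linarith
        · simp [f, hi]
    _ = _ := by
        rw [prod_mul_distrib, prod_ite, prod_const, prod_const_one, mul_one, Fintype.card_pi]
        simp [mul_assoc]

lemma card_triangular_le {ι J : Type*} [LinearOrder J] (κ : ι → J) (Ψ : Finset ι → J → ℤ)
    (m : J → ℤ) (S : Finset J) :
    ∀ (A : Finset ι) (F : Finset (Finset ι)), A.image κ = S → F ⊆ A.powerset →
      (∀ ω ⊆ A, ∀ i ∈ A, i ∉ ω → ∀ j < κ i, Ψ (insert i ω) j = Ψ ω j) →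
      (∀ ω ⊆ A, ∀ i ∈ A, i ∉ ω → Ψ (insert i ω) (κ i) = Ψ ω (κ i) + 1) →
      (∀ ω ∈ F, ∀ i ∈ A, Ψ ω (κ i) = m (κ i)) →
      #F ≤ ∏ j ∈ S, (#{i ∈ A | κ i = j}).choose (#{i ∈ A | κ i = j} / 2) := by
  induction S using Finset.induction_on_max with
  | empty =>
    intro A F hA hF _ _ _
    rw [image_eq_empty] at hA
    subst hA
    simpa using card_le_card hF
  | insert j S hj ih =>
    intro A F hA hF hlt heq hΨ
    have hle : ∀ i ∈ A, κ i ≤ j := by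
      intro i hi
      have : κ i ∈ insert j S := hA ▸ mem_image_of_mem κ hi
      rcases mem_insert.1 this with h | h
      · exact h.le
      · exact (hj _ h).le
    have hjS : j ∉ S := fun h => lt_irrefl _ (hj j h)
    set B := {i ∈ A | κ i < j} with hB
    have hBA : B ⊆ A := filter_subset _ _
    have hBS : B.image κ = S := by
      ext k
      simp only [hB, mem_image, mem_filter]
      constructor
      · rintro ⟨i, ⟨hi, hij⟩, rfl⟩
        have : κ i ∈ insert j S := hA ▸ mem_image_of_mem κ hi
        exact (mem_insert.1 this).resolve_left hij.ne
      · intro hk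
        have : k ∈ A.image κ := hA ▸ mem_insert_of_mem hk
        obtain ⟨i, hi, rfl⟩ := mem_image.1 this
        exact ⟨i, ⟨hi, hj _ hk⟩, rfl⟩
    -- adding elements of the top class
    have hadd : ∀ X ⊆ A, (∀ i ∈ X, κ i = j) → ∀ b ⊆ B,
        (∀ k < j, Ψ (b ∪ X) k = Ψ b k) ∧ Ψ (b ∪ X) j = Ψ b j + #X := by
      intro X
      induction X using Finset.induction_on with
      | empty => intro _ _ b _; simp
      | insert i X hi ihX =>
        intro hXA hX b hb
        obtain ⟨h1, h2⟩ := ihX (fun x hx => hXA (mem_insert_of_mem hx))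
          (fun x hx => hX x (mem_insert_of_mem hx)) b hb
        have hij : κ i = j := hX i (mem_insert_self _ _)
        have hiA : i ∈ A := hXA (mem_insert_self _ _)
        have hib : i ∉ b ∪ X := by
          rw [mem_union, not_or]
          exact ⟨fun h => (mem_filter.1 (hb h)).2.ne hij, hi⟩
        have hsub : b ∪ X ⊆ A := union_subset (hb.trans hBA)
          fun x hx => hXA (mem_insert_of_mem hx)
        rw [union_insert]
        refine ⟨fun k hk => ?_, ?_⟩
        · rw [hlt _ hsub i hiA hib k (hij ▸ hk), h1 k hk]
        · have := heq _ hsub i hiA hib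
          rw [hij] at this
          rw [this, h2, card_insert_of_notMem hi]
          push_cast; ring
    have hsplit : ∀ ω ⊆ A, ω = {i ∈ ω | κ i < j} ∪ {i ∈ ω | κ i = j} := by
      intro ω hω
      ext i
      simp only [mem_union, mem_filter]
      refine ⟨fun h => ?_, fun h => h.elim And.left And.left⟩
      rcases (hle i (hω h)).lt_or_eq with h' | h'
      · exact Or.inl ⟨h, h'⟩
      · exact Or.inr ⟨h, h'⟩
    have hω : ∀ ω ⊆ A, (∀ k < j, Ψ ω k = Ψ {i ∈ ω | κ i < j} k) ∧
        Ψ ω j = Ψ {i ∈ ω | κ i < j} j + #{i ∈ ω | κ i = j} := by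
      intro ω hω
      have := hadd {i ∈ ω | κ i = j} ((filter_subset _ _).trans hω) (by simp)
        {i ∈ ω | κ i < j} (filter_subset_filter _ hω)
      rwa [← hsplit ω hω] at this
    have hFA : ∀ ω ∈ F, ω ⊆ A := fun ω h => mem_powerset.1 (hF h)
    have IH := ih B (F.image fun ω => ω.filter fun i => κ i < j) hBS
      (by
        intro b hb
        obtain ⟨ω, hω', rfl⟩ := mem_image.1 hb
        exact mem_powerset.2 (filter_subset_filter _ (hFA ω hω')))
      (fun ω h i hi => hlt ω (h.trans hBA) i (hBA hi))
      (fun ω h i hi => heq ω (h.trans hBA) i (hBA hi))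
      (by
        intro b hb i hi
        obtain ⟨ω, hω', rfl⟩ := mem_image.1 hb
        rw [← (hω ω (hFA ω hω')).1 _ (mem_filter.1 hi).2]
        exact hΨ ω hω' i (hBA hi))
    have hcl : ∀ k ∈ S, {i ∈ B | κ i = k} = {i ∈ A | κ i = k} := by
      intro k hk
      ext i
      simp only [hB, mem_filter]
      constructor
      · rintro ⟨⟨h1, _⟩, h2⟩; exact ⟨h1, h2⟩
      · rintro ⟨h1, rfl⟩; exact ⟨⟨h1, hj _ hk⟩, rfl⟩
    rw [prod_insert hjS]
    rw [prod_congr rfl fun k hk => by rw [hcl k hk]] at IH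
    refine (card_le_mul_card_image (f := fun ω => ω.filter fun i => κ i < j) F _ ?_).trans
      (Nat.mul_le_mul_left _ IH)
    intro b hb
    have hjA : ∃ i ∈ A, κ i = j := by
      have : j ∈ A.image κ := hA ▸ mem_insert_self _ _
      simpa using this
    obtain ⟨i₀, hi₀, hi₀j⟩ := hjA
    refine le_trans ?_ (Nat.choose_le_middle ((m j - Ψ b j).toNat) _)
    rw [← card_powersetCard]
    refine card_le_card_of_injOn (fun ω => ω.filter fun i => κ i = j) ?_ ?_
    · intro ω hωF
      rw [mem_coe, mem_filter] at hωF
      have h1 := (hω ω (hFA ω hωF.1)).2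
      have h2 := hΨ ω hωF.1 i₀ hi₀
      rw [hi₀j] at h2
      rw [mem_coe, mem_powersetCard]
      refine ⟨filter_subset_filter _ (hFA ω hωF.1), ?_⟩
      rw [hωF.2] at h1
      have h3 : #(ω.filter fun i => κ i = j) = (m j - Ψ b j).toNat := by omega
      exact h3
    · intro ω₁ h₁ ω₂ h₂ h
      rw [mem_coe, mem_filter] at h₁ h₂
      rw [hsplit ω₁ (hFA _ h₁.1), hsplit ω₂ (hFA _ h₂.1)]
      simp only at h
      rw [h₁.2, h₂.2, h]
lemma card_lazy_coin_le {ι J : Type*} [Fintype ι] [LinearOrder J] {Ω : ι → Type*}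
    [∀ i, Fintype (Ω i)] (I : Finset ι) (κ : ι → J) (c c' : ∀ i, Ω i)
    (hc : ∀ i ∈ I, c i ≠ c' i) (Ψ : (∀ i, Ω i) → J → ℤ) (m : J → ℤ)
    (hlt : ∀ a, ∀ i ∈ I, a i = c i → ∀ j < κ i, Ψ (Function.update a i (c' i)) j = Ψ a j)
    (heq : ∀ a, ∀ i ∈ I, a i = c i →
      Ψ (Function.update a i (c' i)) (κ i) = Ψ a (κ i) + 1) :
    (#{a | ∀ i ∈ I, Ψ a (κ i) = m (κ i)} : ℝ) ≤ ∑ a : ∀ i, Ω i, ∏ j ∈ I.image κ,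
      (((#{i ∈ I | (a i = c i ∨ a i = c' i) ∧ κ i = j}).choose
        (#{i ∈ I | (a i = c i ∨ a i = c' i) ∧ κ i = j} / 2) : ℕ) : ℝ) /
        2 ^ #{i ∈ I | (a i = c i ∨ a i = c' i) ∧ κ i = j} := by
  let key : (∀ i, Ω i) → ∀ i, Ω i := fun a i => if i ∈ I ∧ a i = c' i then c i else a i
  refine card_le_sum_of_fiberwise univ _ key _ ?_ (subset_univ _)
  intro b₀ _
  set b := key b₀ with hb
  have hbc' : ∀ i ∈ I, b i ≠ c' i := by
    intro i hi
    simp only [hb, key, hi, true_and]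
    split_ifs with h
    · exact hc i hi
    · exact h
  set A := {i ∈ I | b i = c i} with hA
  let e : Finset ι → ∀ i, Ω i := fun ω i => if i ∈ ω then c' i else b i
  have hkey : ∀ ω ⊆ A, key (e ω) = b := by
    intro ω hω
    funext i
    simp only [key, e]
    by_cases hi : i ∈ ω
    · have := mem_filter.1 (hω hi)
      simp [hi, this.1, this.2]
    · by_cases hI : i ∈ I
      · simp [hi, hI, hbc' i hI]
      · simp [hi, hI]
  have hfib : ∀ a, key a = b → e {i ∈ A | a i = c' i} = a := by
    intro a ha
    funext i
    have hai : key a i = b i := congrFun ha i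
    simp only [key] at hai
    simp only [e, mem_filter, hA]
    by_cases hI : i ∈ I
    · by_cases h : a i = c' i
      · have : b i = c i := by rw [← hai]; simp [hI, h]
        simp [hI, h, this]
      · simp only [h, and_false, if_false] at hai ⊢
        exact hai.symm
    · simp only [hI, false_and, if_false] at hai ⊢
      exact hai.symm
  have hact : ∀ a, key a = b → ∀ i ∈ I, (a i = c i ∨ a i = c' i) ↔ b i = c i := by
    intro a ha i hi
    have hai : key a i = b i := congrFun ha i
    simp only [key, hi, true_and] at hai
    rw [← hai]
    split_ifs with h <;> simp [h]
  have hX : ∀ a, key a = b → ∀ j, {i ∈ I | (a i = c i ∨ a i = c' i) ∧ κ i = j} =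
      {i ∈ A | κ i = j} := by
    intro a ha j
    ext i
    simp only [mem_filter, hA, and_assoc]
    refine and_congr_right fun hi => and_congr_left fun _ => hact a ha i hi
  have hcard : #A ≤ #I := card_filter_le _ _
  have hlow : 2 ^ #A ≤ #{a | key a = b} := by
    rw [← card_powerset]
    refine card_le_card_of_injOn e ?_ ?_
    · intro ω hω
      simpa using hkey ω (mem_powerset.1 hω)
    · intro ω₁ h₁ ω₂ h₂ h
      have h₁ := mem_powerset.1 h₁
      have h₂ := mem_powerset.1 h₂
      have aux : ∀ ω ⊆ A, ω = {i ∈ A | e ω i = c' i} := by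
        intro ω hω
        ext i
        simp only [mem_filter, e]
        constructor
        · intro hi; exact ⟨hω hi, by simp [hi]⟩
        · rintro ⟨hi, h⟩
          by_contra hn
          rw [if_neg hn] at h
          exact hbc' i (mem_filter.1 hi).1 h
      rw [aux ω₁ h₁, aux ω₂ h₂, h]
  have hup : #{a ∈ {a | ∀ i ∈ I, Ψ a (κ i) = m (κ i)} | key a = b} ≤
      ∏ j ∈ I.image κ, (#{i ∈ A | κ i = j}).choose (#{i ∈ A | κ i = j} / 2) := by
    have h1 : #{a ∈ {a | ∀ i ∈ I, Ψ a (κ i) = m (κ i)} | key a = b} ≤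
        #{ω ∈ A.powerset | ∀ i ∈ I, Ψ (e ω) (κ i) = m (κ i)} := by
      refine card_le_card_of_injOn (fun a => A.filter fun i => a i = c' i) ?_ ?_
      · intro a ha
        simp only [coe_filter, mem_filter, mem_univ, true_and, Set.mem_ofPred_eq] at ha
        simp only [coe_filter, Set.mem_ofPred_eq, mem_powerset]
        refine ⟨filter_subset _ _, ?_⟩
        rw [hfib a ha.2]
        exact ha.1
      · intro a₁ h₁ a₂ h₂ h
        simp only [coe_filter, mem_filter, mem_univ, true_and, Set.mem_ofPred_eq] at h₁ h₂
        rw [← hfib a₁ h₁.2, ← hfib a₂ h₂.2]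
        exact congrArg e h
    refine h1.trans ?_
    have h2 := card_triangular_le κ (fun ω => Ψ (e ω)) m (A.image κ) A
      {ω ∈ A.powerset | ∀ i ∈ I, Ψ (e ω) (κ i) = m (κ i)} rfl (filter_subset _ _)
    have hupd : ∀ ω ⊆ A, ∀ i ∈ A, i ∉ ω →
        e (insert i ω) = Function.update (e ω) i (c' i) ∧ e ω i = c i := by
      intro ω hω i hi hiω
      refine ⟨?_, by simp only [e, hiω, if_false]; exact (mem_filter.1 hi).2⟩
      funext k
      by_cases hk : k = i
      · subst hk; simp [e]
      · simp [e, hk]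
    refine (h2 ?_ ?_ ?_).trans ?_
    · intro ω hω i hi hiω j hj
      obtain ⟨h3, h4⟩ := hupd ω hω i hi hiω
      simp only [h3]
      exact hlt _ i (mem_filter.1 hi).1 h4 j hj
    · intro ω hω i hi hiω
      obtain ⟨h3, h4⟩ := hupd ω hω i hi hiω
      simp only [h3]
      exact heq _ i (mem_filter.1 hi).1 h4
    · intro ω hω i hi
      exact (mem_filter.1 hω).2 i (mem_filter.1 hi).1
    · refine prod_le_prod_of_subset_of_one_le' (image_subset_image (filter_subset _ _)) ?_
      intro j _ _
      exact Nat.choose_pos (Nat.div_le_self _ _)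
  have hsum : ∑ j ∈ I.image κ, #{i ∈ A | κ i = j} = #A :=
    (card_eq_sum_card_fiberwise fun i hi =>
      mem_image_of_mem _ (mem_filter.1 hi).1).symm
  set C := ∏ j ∈ I.image κ, (#{i ∈ A | κ i = j}).choose (#{i ∈ A | κ i = j} / 2) with hC
  have hterm : ∀ a ∈ ({a | key a = b} : Finset (∀ i, Ω i)), ∏ j ∈ I.image κ,
      (((#{i ∈ I | (a i = c i ∨ a i = c' i) ∧ κ i = j}).choose
        (#{i ∈ I | (a i = c i ∨ a i = c' i) ∧ κ i = j} / 2) : ℕ) : ℝ) /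
        2 ^ #{i ∈ I | (a i = c i ∨ a i = c' i) ∧ κ i = j} = C / 2 ^ #A := by
    intro a ha
    have ha : key a = b := by simpa using ha
    rw [prod_div_distrib, prod_pow_eq_pow_sum]
    simp only [hX a ha, hsum, hC]
    push_cast
    rfl
  have hfin : (#{a ∈ {a | ∀ i ∈ I, Ψ a (κ i) = m (κ i)} | key a = b} : ℝ) ≤
      ∑ _a ∈ ({a | key a = b} : Finset (∀ i, Ω i)), (C / 2 ^ #A : ℝ) := by
    rw [sum_const, nsmul_eq_mul]
    calc (_ : ℝ) ≤ C := by exact_mod_cast hup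
      _ = 2 ^ #A * (C / 2 ^ #A) := by field_simp
      _ ≤ _ := by
        refine mul_le_mul_of_nonneg_right ?_ (by positivity)
        exact_mod_cast hlow
  rw [← sum_congr rfl hterm] at hfin
  convert hfin

section Coin

variable {ι J : Type*} [Fintype ι] [LinearOrder J] {Ω : ι → Type*} [∀ i, Fintype (Ω i)]

lemma one_sub_inv_two_mul_mem (Q : ℕ) : 0 ≤ (1 - 1 / (2 * Q) : ℝ) ∧ (1 - 1 / (2 * Q) : ℝ) ≤ 1 := by
  rcases Nat.eq_zero_or_pos Q with rfl | h
  · simp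
  · have h : (1 : ℝ) ≤ Q := by exact_mod_cast h
    have : 1 / (2 * (Q : ℝ)) ≤ 1 := by
      rw [div_le_one (by linarith)]; linarith
    exact ⟨by linarith, by linarith [show 0 ≤ 1 / (2 * (Q : ℝ)) by positivity]⟩

lemma choose_half_div_le_one (N : ℕ) : ((N.choose (N / 2) : ℕ) : ℝ) / 2 ^ N ≤ 1 := by
  rw [div_le_one (by positivity)]
  exact_mod_cast Nat.choose_le_two_pow N _

lemma card_coin_classes_le (I : Finset ι) (κ : ι → J) (c c' : ∀ i, Ω i)
    (hc : ∀ i ∈ I, c i ≠ c' i) (Ψ : (∀ i, Ω i) → J → ℤ) (m : J → ℤ)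
    (hlt : ∀ a, ∀ i ∈ I, a i = c i → ∀ j < κ i, Ψ (Function.update a i (c' i)) j = Ψ a j)
    (heq : ∀ a, ∀ i ∈ I, a i = c i →
      Ψ (Function.update a i (c' i)) (κ i) = Ψ a (κ i) + 1)
    (Q : ℕ) (hQ : ∀ i ∈ I, Fintype.card (Ω i) ≤ Q) (N t : ℕ)
    (hN : ∀ j ∈ I.image κ, N ≤ #{i ∈ I | κ i = j}) :
    (#{a | ∀ i ∈ I, Ψ a (κ i) = m (κ i)} : ℝ) ≤
      (#(I.image κ) * (2 ^ t * (1 - 1 / (2 * Q)) ^ N) + (1 / √(t + 1)) ^ #(I.image κ)) *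
        Fintype.card (∀ i, Ω i) := by
  refine (card_lazy_coin_le I κ c c' hc Ψ m hlt heq).trans ?_
  obtain ⟨hq0, hq1⟩ := one_sub_inv_two_mul_mem Q
  let X : (∀ i, Ω i) → J → ℕ := fun a j => #{i ∈ I | (a i = c i ∨ a i = c' i) ∧ κ i = j}
  have hbad : ∀ j ∈ I.image κ, (#{a | X a j < t} : ℝ) ≤
      2 ^ t * (1 - 1 / (2 * Q)) ^ N * Fintype.card (∀ i, Ω i) := by
    intro j hj
    have := card_few_hits_le {i ∈ I | κ i = j} (fun i => ({c i, c' i} : Finset (Ω i)))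
      (fun i _ => ⟨c i, by simp⟩) Q (fun i hi => hQ i (mem_filter.1 hi).1) t
    have hXe : ∀ a, X a j = #{i ∈ {i ∈ I | κ i = j} | a i ∈ ({c i, c' i} : Finset (Ω i))} := by
      intro a
      simp only [X]
      congr 1
      ext i
      simp only [mem_filter, mem_insert, mem_singleton]
      tauto
    simp only [hXe]
    refine this.trans ?_
    gcongr ?_ * _
    refine mul_le_mul_of_nonneg_left ?_ (by positivity)
    exact pow_le_pow_of_le_one hq0 hq1 (hN j hj)
  have hpt : ∀ a, ∏ j ∈ I.image κ, (((X a j).choose (X a j / 2) : ℕ) : ℝ) / 2 ^ X a j ≤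
      (∑ j ∈ I.image κ, if X a j < t then (1 : ℝ) else 0) + (1 / √(t + 1)) ^ #(I.image κ) := by
    intro a
    by_cases h : ∃ j ∈ I.image κ, X a j < t
    · obtain ⟨j, hj, hjt⟩ := h
      have h1 : (1 : ℝ) ≤ ∑ j ∈ I.image κ, if X a j < t then (1 : ℝ) else 0 := by
        refine le_trans (by simp [hjt])
          (single_le_sum (f := fun j => if X a j < t then (1 : ℝ) else 0)
            (fun k _ => by split_ifs <;> norm_num) hj)
      have h2 : ∏ j ∈ I.image κ, (((X a j).choose (X a j / 2) : ℕ) : ℝ) / 2 ^ X a j ≤ 1 :=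
        prod_le_one (fun _ _ => by positivity) fun _ _ => choose_half_div_le_one _
      have h3 : (0 : ℝ) ≤ (1 / √(t + 1)) ^ #(I.image κ) := by positivity
      linarith
    · push Not at h
      have h1 : ∏ j ∈ I.image κ, (((X a j).choose (X a j / 2) : ℕ) : ℝ) / 2 ^ X a j ≤
          ∏ j ∈ I.image κ, (1 / √(t + 1)) :=
        prod_le_prod (fun _ _ => by positivity) fun j hj => choose_half_div_le _ _ (h j hj)
      rw [prod_const] at h1
      have h2 : (0 : ℝ) ≤ ∑ j ∈ I.image κ, if X a j < t then (1 : ℝ) else 0 :=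
        sum_nonneg fun k _ => by split_ifs <;> norm_num
      linarith
  refine (sum_le_sum fun a _ => hpt a).trans ?_
  rw [sum_add_distrib, sum_comm, add_mul]
  refine add_le_add ?_ ?_
  · calc ∑ j ∈ I.image κ, ∑ a, (if X a j < t then (1 : ℝ) else 0)
        = ∑ j ∈ I.image κ, (#{a | X a j < t} : ℝ) := by simp
      _ ≤ ∑ j ∈ I.image κ, 2 ^ t * (1 - 1 / (2 * Q)) ^ N * (Fintype.card (∀ i, Ω i) : ℝ) :=
          sum_le_sum hbad
      _ = _ := by rw [sum_const, nsmul_eq_mul]; ring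
  · rw [sum_const, nsmul_eq_mul, mul_comm, card_univ]

lemma card_coin_injOn_le (I : Finset ι) (κ : ι → J) (hκ : Set.InjOn κ I) (c c' : ∀ i, Ω i)
    (hc : ∀ i ∈ I, c i ≠ c' i) (Ψ : (∀ i, Ω i) → J → ℤ) (m : J → ℤ)
    (hlt : ∀ a, ∀ i ∈ I, a i = c i → ∀ j < κ i, Ψ (Function.update a i (c' i)) j = Ψ a j)
    (heq : ∀ a, ∀ i ∈ I, a i = c i →
      Ψ (Function.update a i (c' i)) (κ i) = Ψ a (κ i) + 1)
    (Q : ℕ) (hQ : ∀ i ∈ I, Fintype.card (Ω i) ≤ Q) (t : ℕ) :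
    (#{a | ∀ i ∈ I, Ψ a (κ i) = m (κ i)} : ℝ) ≤
      (2 ^ t * (1 - 1 / (2 * Q)) ^ #I + (1 / 2) ^ t) * Fintype.card (∀ i, Ω i) := by
  refine (card_lazy_coin_le I κ c c' hc Ψ m hlt heq).trans ?_
  let Y : (∀ i, Ω i) → ℕ := fun a => #{i ∈ I | a i ∈ ({c i, c' i} : Finset (Ω i))}
  have hbad := card_few_hits_le I (fun i => ({c i, c' i} : Finset (Ω i)))
    (fun i _ => ⟨c i, by simp⟩) Q hQ t
  have hpt : ∀ a : ∀ i, Ω i, ∏ j ∈ I.image κ,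
      (((#{i ∈ I | (a i = c i ∨ a i = c' i) ∧ κ i = j}).choose
        (#{i ∈ I | (a i = c i ∨ a i = c' i) ∧ κ i = j} / 2) : ℕ) : ℝ) /
        2 ^ #{i ∈ I | (a i = c i ∨ a i = c' i) ∧ κ i = j} = (1 / 2) ^ Y a := by
    intro a
    rw [prod_image hκ]
    have : ∀ i ∈ I, (((#{k ∈ I | (a k = c k ∨ a k = c' k) ∧ κ k = κ i}).choose
        (#{k ∈ I | (a k = c k ∨ a k = c' k) ∧ κ k = κ i} / 2) : ℕ) : ℝ) /
        2 ^ #{k ∈ I | (a k = c k ∨ a k = c' k) ∧ κ k = κ i} =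
        if a i ∈ ({c i, c' i} : Finset (Ω i)) then (1 / 2) else 1 := by
      intro i hi
      by_cases h : a i = c i ∨ a i = c' i
      · have : {k ∈ I | (a k = c k ∨ a k = c' k) ∧ κ k = κ i} = {i} := by
          ext k
          simp only [mem_filter, mem_singleton]
          refine ⟨fun hk => hκ hk.1 hi hk.2.2, ?_⟩
          rintro rfl
          exact ⟨hi, h, rfl⟩
        rw [this]
        simp [h]
      · have : {k ∈ I | (a k = c k ∨ a k = c' k) ∧ κ k = κ i} = ∅ := by
          ext k
          simp only [mem_filter, notMem_empty, iff_false]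
          rintro ⟨hk, hk2, hk3⟩
          exact h (hκ hk hi hk3 ▸ hk2)
        rw [this]
        simp [h]
    rw [prod_congr rfl this, prod_ite, prod_const, prod_const_one, mul_one]
  have hpt2 : ∀ a, (1 / 2 : ℝ) ^ Y a ≤ (if Y a < t then (1 : ℝ) else 0) + (1 / 2) ^ t := by
    intro a
    split_ifs with h
    · have : (1 / 2 : ℝ) ^ Y a ≤ 1 := pow_le_one₀ (by norm_num) (by norm_num)
      have h2 : (0 : ℝ) ≤ (1 / 2) ^ t := by positivity
      linarith
    · rw [zero_add]
      exact pow_le_pow_of_le_one (by norm_num) (by norm_num) (not_lt.1 h)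
  rw [sum_congr rfl fun a _ => hpt a]
  refine (sum_le_sum fun a _ => hpt2 a).trans ?_
  rw [sum_add_distrib, add_mul]
  refine add_le_add ?_ ?_
  · simpa [Y] using hbad
  · rw [sum_const, nsmul_eq_mul, mul_comm, card_univ]

end Coin

lemma card_coin_classes_flip_le {ι : Type*} [Fintype ι] {Ω : ι → Type*} [∀ i, Fintype (Ω i)]
    (I : Finset ι) (α β : ι → ℕ) (c c' : ∀ i, Ω i)
    (hc : ∀ i ∈ I, c i ≠ c' i) (Ψ : (∀ i, Ω i) → ℕ → ℤ) (m : ℕ → ℤ)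
    (hflip : ∀ a, ∀ i ∈ I, a i = c i → ∀ j, Ψ (Function.update a i (c' i)) j =
      Ψ a j + (if j = α i then 1 else 0) - (if j = β i then 1 else 0))
    (hαβ : (∀ i ∈ I, α i < β i) ∨ (∀ i ∈ I, β i < α i))
    (Q : ℕ) (hQ : ∀ i ∈ I, Fintype.card (Ω i) ≤ Q) (N t : ℕ)
    (hN : ∀ j ∈ I.image α, N ≤ #{i ∈ I | α i = j}) :
    (#{a | ∀ j, Ψ a j = m j} : ℝ) ≤
      (#(I.image α) * (2 ^ t * (1 - 1 / (2 * Q)) ^ N) + (1 / √(t + 1)) ^ #(I.image α)) *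
        Fintype.card (∀ i, Ω i) := by
  rcases hαβ with h | h
  · refine le_trans ?_ (card_coin_classes_le I α c c' hc Ψ m ?_ ?_ Q hQ N t hN)
    · exact_mod_cast card_le_card (fun a ha => by
        simp only [mem_filter, mem_univ, true_and] at ha ⊢
        exact fun i _ => ha (α i))
    · intro a i hi hai j hj
      rw [hflip a i hi hai, if_neg hj.ne, if_neg (hj.trans (h i hi)).ne]
      ring
    · intro a i hi hai
      rw [hflip a i hi hai, if_pos rfl, if_neg (h i hi).ne]
      ring
  · refine le_trans ?_ (card_coin_classes_le (J := ℕᵒᵈ) I α c c' hc Ψ m ?_ ?_ Q hQ N t hN)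
    · exact_mod_cast card_le_card (fun a ha => by
        simp only [mem_filter, mem_univ, true_and] at ha ⊢
        exact fun i _ => ha (α i))
    · intro a i hi hai j hj
      have hj' : α i < OrderDual.ofDual j := hj
      refine (hflip a i hi hai (OrderDual.ofDual j)).trans ?_
      rw [if_neg hj'.ne', if_neg ((h i hi).trans hj').ne']
      rw [add_zero, sub_zero]
      rfl
    · intro a i hi hai
      refine (hflip a i hi hai (α i)).trans ?_
      rw [if_pos rfl, if_neg (h i hi).ne']
      ring

lemma card_coin_injOn_flip_le {ι : Type*} [Fintype ι] {Ω : ι → Type*} [∀ i, Fintype (Ω i)]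
    (I : Finset ι) (α β : ι → ℕ) (hα : Set.InjOn α I) (c c' : ∀ i, Ω i)
    (hc : ∀ i ∈ I, c i ≠ c' i) (Ψ : (∀ i, Ω i) → ℕ → ℤ) (m : ℕ → ℤ)
    (hflip : ∀ a, ∀ i ∈ I, a i = c i → ∀ j, Ψ (Function.update a i (c' i)) j =
      Ψ a j + (if j = α i then 1 else 0) - (if j = β i then 1 else 0))
    (hαβ : (∀ i ∈ I, α i < β i) ∨ (∀ i ∈ I, β i < α i))
    (Q : ℕ) (hQ : ∀ i ∈ I, Fintype.card (Ω i) ≤ Q) (t : ℕ) :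
    (#{a | ∀ j, Ψ a j = m j} : ℝ) ≤
      (2 ^ t * (1 - 1 / (2 * Q)) ^ #I + (1 / 2) ^ t) * Fintype.card (∀ i, Ω i) := by
  rcases hαβ with h | h
  · refine le_trans ?_ (card_coin_injOn_le I α hα c c' hc Ψ m ?_ ?_ Q hQ t)
    · exact_mod_cast card_le_card (fun a ha => by
        simp only [mem_filter, mem_univ, true_and] at ha ⊢
        exact fun i _ => ha (α i))
    · intro a i hi hai j hj
      rw [hflip a i hi hai, if_neg hj.ne, if_neg (hj.trans (h i hi)).ne]
      ring
    · intro a i hi hai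
      rw [hflip a i hi hai, if_pos rfl, if_neg (h i hi).ne]
      ring
  · refine le_trans ?_ (card_coin_injOn_le (J := ℕᵒᵈ) I α hα c c' hc Ψ m ?_ ?_ Q hQ t)
    · exact_mod_cast card_le_card (fun a ha => by
        simp only [mem_filter, mem_univ, true_and] at ha ⊢
        exact fun i _ => ha (α i))
    · intro a i hi hai j hj
      have hj' : α i < OrderDual.ofDual j := hj
      refine (hflip a i hi hai (OrderDual.ofDual j)).trans ?_
      rw [if_neg hj'.ne', if_neg ((h i hi).trans hj').ne']
      rw [add_zero, sub_zero]
      rfl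
    · intro a i hi hai
      refine (hflip a i hi hai (α i)).trans ?_
      rw [if_pos rfl, if_neg (h i hi).ne']
      ring

/-- Among families of coins whose flips move a unit of mass out of level `β i t` to the level
`η i + t`, the profile `Ψ` is anticoncentrated. -/
lemma card_gadgets_le {ι : Type*} [Fintype ι] {Ω : ι → Type*} [∀ i, Fintype (Ω i)]
    (r k N s : ℕ) (hr : 1 ≤ r) (hN1 : 1 ≤ N) (hcard : 2 * (k * (r * N)) ≤ Fintype.card ι)
    (c c' : ∀ i, ℕ → Ω i) (hc : ∀ i, ∀ t ≤ 2 * r, c i t ≠ c' i t)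
    (η : ι → ℕ) (β : ι → ℕ → ℕ) (hβ : ∀ i, Antitone (β i))
    (Ψ : (∀ i, Ω i) → ℕ → ℤ) (m : ℕ → ℤ)
    (hflip : ∀ a i, ∀ t ≤ 2 * r, a i = c i t → ∀ j, Ψ (Function.update a i (c' i t)) j =
      Ψ a j + (if j = η i + t then 1 else 0) - (if j = β i t then 1 else 0))
    (Q : ℕ) (hQ : ∀ i, Fintype.card (Ω i) ≤ Q) :
    (#{a | ∀ j, Ψ a j = m j} : ℝ) ≤
      ((r * (2 ^ s * (1 - 1 / (2 * Q)) ^ N) + (1 / √(s + 1)) ^ r) +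
        (2 ^ s * (1 - 1 / (2 * Q)) ^ k + (1 / 2) ^ s)) * Fintype.card (∀ i, Ω i) := by
  obtain ⟨hq0, hq1⟩ := one_sub_inv_two_mul_mem Q
  -- a common type for half of the coins
  obtain ⟨I₁, δ, hI₁, hδ, htype⟩ : ∃ (I₁ : Finset ι) (δ : ℕ), k * (r * N) ≤ #I₁ ∧ δ ≤ r ∧
      ((∀ i ∈ I₁, ∀ t < r, η i + (δ + t) < β i (δ + t)) ∨
        (∀ i ∈ I₁, ∀ t < r, 0 < t + δ → β i (δ + t) < η i + (δ + t))) ∧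
      ((∀ i ∈ I₁, ∀ t < r, η i + (δ + t) < β i (δ + t)) ∨ 0 < δ) := by
    let A : Finset ι := {i | η i + r ≤ β i r}
    by_cases hA : k * (r * N) ≤ #A
    · have h : ∀ i ∈ A, ∀ t < r, η i + (0 + t) < β i (0 + t) := by
        intro i hi t ht
        have h1 : η i + r ≤ β i r := (mem_filter.1 hi).2
        have h2 := hβ i ht.le
        rw [zero_add]
        omega
      exact ⟨A, 0, hA, by omega, Or.inl h, Or.inl h⟩
    · refine ⟨Aᶜ, r, ?_, le_rfl, Or.inr ?_, Or.inr hr⟩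
      · rw [card_compl]; omega
      · intro i hi t ht _
        have h1 : ¬ η i + r ≤ β i r := by simpa [A] using hi
        have h2 := hβ i (Nat.le_add_right r t)
        omega
  have htype' : ∀ (I : Finset ι) (τ : ι → ℕ), I ⊆ I₁ → (∀ i ∈ I, τ i < r) →
      (∀ i ∈ I, η i + (δ + τ i) < β i (δ + τ i)) ∨ (∀ i ∈ I, β i (δ + τ i) < η i + (δ + τ i)) := by
    intro I τ hI hτ
    rcases htype with ⟨h | h, h'⟩
    · exact Or.inl fun i hi => h i (hI hi) _ (hτ i hi)
    · rcases h' with h' | h'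
      · exact Or.inl fun i hi => h' i (hI hi) _ (hτ i hi)
      · exact Or.inr fun i hi => h i (hI hi) _ (hτ i hi) (by omega)
  have hE1 : 0 ≤ r * (2 ^ s * (1 - 1 / (2 * (Q : ℝ))) ^ N) + (1 / √(s + 1)) ^ r := by positivity
  have hE2 : 0 ≤ 2 ^ s * (1 - 1 / (2 * (Q : ℝ))) ^ k + (1 / 2) ^ s := by positivity
  by_cases hk : k ≤ #(I₁.image η)
  · -- many values of `η`
    obtain ⟨I, hII, hIinj, hIk⟩ : ∃ I ⊆ I₁, Set.InjOn η I ∧ k ≤ #I := by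
      have := (I₁ : Set ι).surjOn_image η
      obtain ⟨u, hu, hinj, himg⟩ := this.exists_subset_injOn_image_eq
      have huf : u.Finite := I₁.finite_toSet.subset hu
      refine ⟨huf.toFinset, by simpa using hu, by simpa using hinj, ?_⟩
      refine hk.trans (le_of_eq ?_)
      rw [← card_image_of_injOn (s := huf.toFinset) (f := η) (by simpa using hinj)]
      congr 1
      apply coe_injective
      rw [coe_image, coe_image, Set.Finite.coe_toFinset]
      exact himg.symm
    refine (card_coin_injOn_flip_le I (fun i => η i + (δ + 0)) (fun i => β i (δ + 0)) ?_
      (fun i => c i (δ + 0)) (fun i => c' i (δ + 0)) (fun i _ => hc i _ (by omega)) Ψ m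
      (fun a i _ h j => hflip a i _ (by omega) h j) (htype' I (fun _ => 0) hII fun _ _ => hr)
      Q (fun i _ => hQ i) s).trans ?_
    · intro i hi j hj h
      exact hIinj hi hj (by simpa using h)
    · refine mul_le_mul_of_nonneg_right ?_ (Nat.cast_nonneg _)
      refine le_trans ?_ (le_add_of_nonneg_left hE1)
      refine add_le_add_left ?_ _
      exact mul_le_mul_of_nonneg_left (pow_le_pow_of_le_one hq0 hq1 hIk) (by positivity)
  · -- a popular value of `η`
    have hne : (I₁.image η).Nonempty ∨ k = 0 := by
      by_contra! h
      have h0 : I₁ = ∅ := by simpa using h.1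
      rw [h0] at hI₁
      have : 0 < k * (r * N) := by
        have := Nat.pos_of_ne_zero h.2
        positivity
      simp at hI₁
      omega
    have hne : (I₁.image η).Nonempty := hne.resolve_right (by omega)
    obtain ⟨y, -, hy⟩ := exists_le_card_fiber_of_mul_le_card_of_maps_to
      (s := I₁) (t := I₁.image η) (f := η) (n := r * N) (fun a ha => mem_image_of_mem _ ha) hne
      ((Nat.mul_le_mul_right _ (by omega)).trans hI₁)
    obtain ⟨f⟩ : Nonempty (Fin r × Fin N ↪ {x // x ∈ ({i ∈ I₁ | η i = y} : Finset ι)}) :=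
      Function.Embedding.nonempty_of_card_le (by
        rw [Fintype.card_coe]; simpa using hy)
    let F : Fin r × Fin N → ι := fun p => f p
    have hF : Function.Injective F := Subtype.val_injective.comp f.injective
    have hFm : ∀ p, F p ∈ I₁ ∧ η (F p) = y := fun p => mem_filter.1 (f p).2
    let τ : ι → ℕ := Function.extend F (fun p => (p.1 : ℕ)) 0
    have hτ : ∀ p, τ (F p) = p.1 := fun p => hF.extend_apply _ _ _
    let I : Finset ι := univ.image F
    have hI : ∀ i ∈ I, ∃ p, F p = i := fun i hi => by simpa [I] using hi
    let α : ι → ℕ := fun i => η i + (δ + τ i)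
    have hα : ∀ p, α (F p) = y + (δ + p.1) := fun p => by simp [α, hτ, (hFm p).2]
    have hcard' : #(I.image α) = r := by
      have : I.image α = (univ : Finset (Fin r)).image (fun i : Fin r => y + (δ + (i : ℕ))) := by
        ext x
        simp only [I, mem_image, mem_univ, true_and, exists_exists_eq_and, hα]
        constructor
        · rintro ⟨p, hp⟩; exact ⟨p.1, hp⟩
        · rintro ⟨i, hi⟩; exact ⟨(i, ⟨0, hN1⟩), hi⟩
      rw [this, card_image_of_injective, card_univ, Fintype.card_fin]
      intro i j h
      simp only at h
      exact Fin.ext (by omega)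
    have hτr : ∀ i ∈ I, τ i < r := by
      intro i hi
      obtain ⟨p, rfl⟩ := hI i hi
      rw [hτ]; exact p.1.2
    have hcl : ∀ j ∈ I.image α, N ≤ #{i ∈ I | α i = j} := by
      intro j hj
      obtain ⟨i, hi, rfl⟩ := mem_image.1 hj
      obtain ⟨p, rfl⟩ := hI i hi
      have h1 : (univ : Finset (Fin N)).image (fun x => F (p.1, x)) ⊆ {i ∈ I | α i = α (F p)} := by
        intro z hz
        obtain ⟨x, -, rfl⟩ := mem_image.1 hz
        simp [I, hα]
      refine le_trans (le_of_eq ?_) (card_le_card h1)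
      rw [card_image_of_injective, card_univ, Fintype.card_fin]
      intro x x' h
      have := hF h
      simpa using this
    refine (card_coin_classes_flip_le I α (fun i => β i (δ + τ i))
      (fun i => c i (min (δ + τ i) (2 * r))) (fun i => c' i (min (δ + τ i) (2 * r)))
      (fun i _ => hc i _ (min_le_right _ _)) Ψ m ?_
      (htype' I τ ?_ hτr) Q (fun i _ => hQ i) N s hcl).trans ?_
    · intro a i hi h j
      have h1 : min (δ + τ i) (2 * r) = δ + τ i := by
        have := hτr i hi
        omega
      simp only [h1] at h ⊢
      exact hflip a i _ (by have := hτr i hi; omega) h j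
    · intro i hi
      obtain ⟨p, rfl⟩ := hI i hi
      exact (hFm p).1
    · rw [hcard']
      refine mul_le_mul_of_nonneg_right ?_ (Nat.cast_nonneg _)
      exact le_add_of_nonneg_right hE2

/-! ### Balls in bins -/

/-- The load of bin `u` when the bins start with loads `h` and the balls are placed by `a`. -/
noncomputable def load {S V : Type*} [Fintype S] (h : V → ℕ) (a : S → V) (u : V) : ℕ :=
  h u + #{v | a v = u}

lemma exists_index {S : Type*} (B : Finset S) :
    ∃ idx : S → ℕ, Set.InjOn idx B ∧ B.image idx = range #B := by
  refine ⟨fun v => if h : v ∈ B then (B.equivFin ⟨v, h⟩ : ℕ) else 0, ?_, ?_⟩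
  · intro x hx y hy hxy
    have hx : x ∈ B := hx
    have hy : y ∈ B := hy
    simp only [hx, hy, dif_pos] at hxy
    have := B.equivFin.injective (Fin.ext hxy)
    simpa using this
  · ext n
    simp only [mem_image, mem_range]
    constructor
    · rintro ⟨v, hv, rfl⟩
      rw [dif_pos hv]
      exact (B.equivFin ⟨v, hv⟩).2
    · intro hn
      refine ⟨B.equivFin.symm ⟨n, hn⟩, (B.equivFin.symm ⟨n, hn⟩).2, ?_⟩
      simp

lemma card_index_lt {S : Type*} (B : Finset S) (idx : S → ℕ) (hi : Set.InjOn idx B)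
    (him : B.image idx = range #B) (t : ℕ) (ht : t ≤ #B) : #{v ∈ B | idx v < t} = t := by
  have h1 : ({v ∈ B | idx v < t}).image idx = range t := by
    ext n
    simp only [mem_image, mem_filter, mem_range]
    constructor
    · rintro ⟨v, ⟨_, h⟩, rfl⟩; exact h
    · intro h
      have : n ∈ B.image idx := by rw [him, mem_range]; omega
      obtain ⟨v, hv, rfl⟩ := mem_image.1 this
      exact ⟨v, ⟨hv, h⟩, rfl⟩
  have h2 := congrArg card h1
  rwa [card_range, card_image_of_injOn (hi.mono fun v hv => (mem_filter.1 hv).1)] at h2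

section Balls

variable {S V : Type*} [Fintype S]

lemma load_update (h : V → ℕ) (a : S → V) (v : S) (u w : V) :
    load h (Function.update a v u) w + (if w = a v then 1 else 0) =
      load h a w + (if w = u then 1 else 0) := by
  have key : ∀ x : S → V, #{y | x y = w} = #{y ∈ univ.erase v | x y = w} +
      (if w = x v then 1 else 0) := by
    intro x
    conv_lhs => rw [← insert_erase (mem_univ v)]
    rw [filter_insert]
    split_ifs with h1 h2 h2
    · rw [card_insert_of_notMem (by simp)]
    · exact absurd h1.symm h2
    · exact absurd h2.symm h1
    · rfl
  unfold load
  rw [key, key a]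
  have : {y ∈ univ.erase v | Function.update a v u y = w} = {y ∈ univ.erase v | a y = w} := by
    refine filter_congr fun y hy => ?_
    rw [Function.update_of_ne (ne_of_mem_erase hy)]
  rw [this, Function.update_self]
  ring

lemma sum_load [Fintype V] (h : V → ℕ) (a : S → V) :
    ∑ u, load h a u = ∑ u, h u + Fintype.card S := by
  simp only [load, sum_add_distrib]
  congr 1
  rw [← card_univ]
  exact (card_eq_sum_card_fiberwise fun _ _ => mem_univ _).symm

lemma card_level_flip [Fintype V] (f f' : V → ℕ) (u b : V) (hub : b ≠ u) (α β : ℕ)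
    (hf : ∀ w, f' w + (if w = b then 1 else 0) = f w + (if w = u then 1 else 0))
    (hu : f u = α) (hb : f b = β + 1) (j : ℕ) :
    -(#{w | f' w ≤ j} : ℤ) = -(#{w | f w ≤ j} : ℤ) + (if j = α then 1 else 0) -
      (if j = β then 1 else 0) := by
  have h1 : (∑ w, ((if f w ≤ j then (1 : ℤ) else 0) - if f' w ≤ j then (1 : ℤ) else 0)) =
      ∑ w, ((if w = u then if j = α then (1 : ℤ) else 0 else 0) -
        (if w = b then if j = β then (1 : ℤ) else 0 else 0)) := by
    refine sum_congr rfl fun w _ => ?_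
    have := hf w
    by_cases h1 : w = u
    · subst h1
      simp only [if_true, hub.symm, if_false] at this ⊢
      split_ifs <;> omega
    · by_cases h2 : w = b
      · subst h2
        simp only [if_true, hub, if_false] at this ⊢
        split_ifs <;> omega
      · simp only [h1, h2, if_false, add_zero] at this ⊢
        rw [this]; ring
  rw [sum_sub_distrib, sum_sub_distrib, sum_ite_eq', sum_ite_eq'] at h1
  simp only [mem_univ, if_true, sum_boole] at h1
  linarith

lemma card_level_le [Fintype V] (f : V → ℕ) (M : ℕ → ℕ) (hM : ∀ k, #{u | f u = k} = M k) (j : ℕ) :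
    #{w | f w ≤ j} = ∑ k ∈ range (j + 1), M k := by
  rw [card_eq_sum_card_fiberwise (t := range (j + 1)) (f := f)
    (fun w hw => by simpa [Nat.lt_succ_iff] using hw)]
  refine sum_congr rfl fun k hk => ?_
  rw [← hM k, filter_filter]
  congr 1
  refine filter_congr fun w _ => ?_
  have := mem_range.1 hk
  constructor
  · exact fun h => h.2
  · intro h; exact ⟨by omega, h⟩


lemma card_loads_local_le [Fintype V] {ι : Type*} [Fintype ι] (allowed : S → Finset V) (a₀ : S → V)
    (h : V → ℕ) (M : ℕ → ℕ) (r k N s Qm : ℕ) (hr : 1 ≤ r) (hN : 1 ≤ N)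
    (hcard : 2 * (k * (r * N)) ≤ Fintype.card ι) (u : ι → V) (B : ι → Finset S)
    (light : V → Prop) (hmax : ∀ v, #(allowed v) ≤ Qm)
    (hlight : ∀ g, ∀ v ∈ B g, 2 ≤ #{w ∈ allowed v | light w})
    (hB : ∀ g, #(B g) = 2 * r + 1) (huB : ∀ g, ∀ v ∈ B g, u g ∈ allowed v)
    (hu : ∀ g, light (u g))
    (hsep : ∀ g g', g ≠ g' → ∀ w, light w → ∀ v ∈ B g, ∀ v' ∈ B g', w ∈ allowed v →
      w ∉ allowed v')
    (hout : ∀ v, (∀ g, v ∉ B g) → allowed v = {a₀ v}) :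
    (#{a ∈ Fintype.piFinset allowed | ∀ k, #{u | load h a u = k} = M k} : ℝ) ≤
      ((r * (2 ^ s * (1 - 1 / (2 * ((Qm ^ (2 * r + 1) : ℕ) : ℝ))) ^ N) + (1 / √(s + 1)) ^ r) +
        (2 ^ s * (1 - 1 / (2 * ((Qm ^ (2 * r + 1) : ℕ) : ℝ))) ^ k + (1 / 2) ^ s)) *
        #(Fintype.piFinset allowed) := by
  have hdisj : ∀ g g', g ≠ g' → ∀ v ∈ B g, v ∉ B g' := fun g g' hne v hv hv' =>
    hsep g g' hne (u g) (hu g) v hv v hv' (huB g v hv) (huB g v hv)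
  have halt : ∀ g, ∃ alt : S → V, ∀ v ∈ B g, alt v ∈ allowed v ∧ light (alt v) ∧ alt v ≠ u g := by
    intro g
    have : ∀ v, ∃ w, v ∈ B g → w ∈ allowed v ∧ light w ∧ w ≠ u g := by
      intro v
      by_cases hv : v ∈ B g
      · obtain ⟨w, hw, hne⟩ := exists_mem_ne (hlight g v hv) (u g)
        exact ⟨w, fun _ => ⟨(mem_filter.1 hw).1, (mem_filter.1 hw).2, hne⟩⟩
      · exact ⟨u g, fun h => absurd h hv⟩
    choose alt h using this
    exact ⟨alt, h⟩
  choose alt halt using halt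
  choose idx hidx himg using fun g => exists_index (B g)
  have hcoin : ∀ g, ∃ v ∈ B g, idx g v = 2 * r := by
    intro g
    have : 2 * r ∈ (B g).image (idx g) := by rw [himg, hB, mem_range]; omega
    simpa using this
  choose coin hcB hci using hcoin
  let Ωs : ι → Finset (S → V) := fun g =>
    Fintype.piFinset fun v => if v ∈ B g then allowed v else {a₀ v}
  have hΩs : ∀ g x, x ∈ Ωs g ↔ (∀ v ∈ B g, x v ∈ allowed v) ∧ ∀ v, v ∉ B g → x v = a₀ v := by
    intro g x
    simp only [Ωs, Fintype.mem_piFinset]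
    constructor
    · intro hx
      refine ⟨fun v hv => by simpa [hv] using hx v, fun v hv => by simpa [hv] using hx v⟩
    · rintro ⟨h1, h2⟩ v
      split_ifs with hv
      · exact h1 v hv
      · rw [mem_singleton]; exact h2 v hv
  let Φ : (∀ g, Ωs g) → S → V := fun ω v =>
    if hv : ∃ g, v ∈ B g then (ω hv.choose).1 v else a₀ v
  have hΦ1 : ∀ ω g, ∀ v ∈ B g, Φ ω v = (ω g).1 v := by
    intro ω g v hv
    have hex : ∃ g, v ∈ B g := ⟨g, hv⟩
    have hg : hex.choose = g := by
      by_contra hne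
      exact hdisj _ _ hne v hex.choose_spec hv
    simp only [Φ, hex, dif_pos]
    rw [hg]
  have hΦ0 : ∀ ω v, (∀ g, v ∉ B g) → Φ ω v = a₀ v := by
    intro ω v hv
    simp only [Φ]
    rw [dif_neg (by simpa using hv)]
  have hΦmem : ∀ ω, Φ ω ∈ Fintype.piFinset allowed := by
    intro ω
    rw [Fintype.mem_piFinset]
    intro v
    by_cases hv : ∃ g, v ∈ B g
    · obtain ⟨g, hg⟩ := hv
      rw [hΦ1 ω g v hg]
      exact ((hΩs g _).1 (ω g).2).1 v hg
    · push Not at hv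
      rw [hΦ0 ω v hv, hout v hv]
      exact mem_singleton_self _
  have hΦinj : Function.Injective Φ := by
    intro ω ω' heq
    funext g
    apply Subtype.ext
    funext v
    by_cases hv : v ∈ B g
    · rw [← hΦ1 ω g v hv, ← hΦ1 ω' g v hv, heq]
    · rw [((hΩs g _).1 (ω g).2).2 v hv, ((hΩs g _).1 (ω' g).2).2 v hv]
  have hΦsurj : ∀ a ∈ Fintype.piFinset allowed, ∃ ω, Φ ω = a := by
    intro a ha
    rw [Fintype.mem_piFinset] at ha
    have hΘ : ∀ g, (fun v => if v ∈ B g then a v else a₀ v) ∈ Ωs g := by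
      intro g
      rw [hΩs]
      refine ⟨fun v hv => by simpa [hv] using ha v, fun v hv => by simp [hv]⟩
    let Θ : ∀ g, Ωs g := fun g => ⟨_, hΘ g⟩
    refine ⟨Θ, ?_⟩
    funext v
    by_cases hv : ∃ g, v ∈ B g
    · obtain ⟨g, hg⟩ := hv
      refine (hΦ1 Θ g v hg).trans ?_
      simp [Θ, hg]
    · push Not at hv
      refine (hΦ0 Θ v hv).trans ?_
      have := ha v
      rw [hout v hv, mem_singleton] at this
      exact this.symm
  have hcardΩ : Fintype.card (∀ g, Ωs g) ≤ #(Fintype.piFinset allowed) := by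
    rw [← card_univ, ← card_image_of_injective _ hΦinj]
    refine card_le_card fun a ha => ?_
    obtain ⟨ω, -, rfl⟩ := mem_image.1 ha
    exact hΦmem ω
  have hQ : ∀ g, Fintype.card (Ωs g) ≤ Qm ^ (2 * r + 1) := by
    intro g
    rw [Fintype.card_coe, Fintype.card_piFinset, ← hB g, ← prod_const]
    rw [← prod_subset (subset_univ (B g)) (fun v _ hv => by simp [hv])]
    exact prod_le_prod' fun v hv => by simpa [hv] using hmax v
  let base : V → ℕ := fun w => h w + #{v | (∀ g, v ∉ B g) ∧ a₀ v = w}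
  have hload : ∀ ω g w, (∀ g', g' ≠ g → ∀ v ∈ B g', w ∉ allowed v) →
      load h (Φ ω) w = base w + #{v ∈ B g | (ω g).1 v = w} := by
    intro ω g w hiso
    simp only [load, base, add_assoc]
    congr 1
    rw [← card_union_of_disjoint]
    · congr 1
      ext v
      simp only [mem_filter, mem_univ, true_and, mem_union]
      by_cases hv : ∃ g', v ∈ B g'
      · obtain ⟨g', hg'⟩ := hv
        have hn : ¬ ∀ g, v ∉ B g := fun hh => hh g' hg'
        simp only [hn, false_and, false_or]
        by_cases hgg : g' = g
        · subst hgg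
          rw [hΦ1 ω g' v hg']
          simp [hg']
        · have h1 : v ∉ B g := hdisj g' g hgg v hg'
          simp only [h1, false_and, iff_false]
          intro hw
          apply hiso g' hgg v hg'
          rw [← hw, hΦ1 ω g' v hg']
          exact ((hΩs g' _).1 (ω g').2).1 v hg'
      · push Not at hv
        rw [hΦ0 ω v hv]
        simp [hv]
    · rw [disjoint_left]
      intro v hv hv'
      exact (mem_filter.1 hv).2.1 g (mem_filter.1 hv').1
  let b : ι → V := fun g => alt g (coin g)
  have hbu : ∀ g, b g ≠ u g := fun g => (halt g _ (hcB g)).2.2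
  have hcmem : ∀ g t, (fun v => if v ∈ B g then (if idx g v < t then u g else alt g v) else a₀ v) ∈
      Ωs g := by
    intro g t
    rw [hΩs]
    refine ⟨fun v hv => ?_, fun v hv => by simp [hv]⟩
    simp only [hv, if_true]
    split_ifs
    · exact huB g v hv
    · exact (halt g v hv).1
  let c : ∀ g, ℕ → Ωs g := fun g t => ⟨_, hcmem g t⟩
  have hc : ∀ g t v, (c g t).1 v =
    if v ∈ B g then (if idx g v < t then u g else alt g v) else a₀ v := fun _ _ _ => rfl
  have hcmem' : ∀ g t, Function.update (c g t).1 (coin g) (u g) ∈ Ωs g := by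
    intro g t
    obtain ⟨h1, h2⟩ := (hΩs g _).1 (c g t).2
    rw [hΩs]
    refine ⟨fun v hv => ?_, fun v hv => ?_⟩
    · by_cases hvc : v = coin g
      · subst hvc; simpa using huB g _ hv
      · simpa [hvc] using h1 v hv
    · have : v ≠ coin g := by rintro rfl; exact hv (hcB g)
      simpa [this] using h2 v hv
  let c' : ∀ g, ℕ → Ωs g := fun g t => ⟨_, hcmem' g t⟩
  have hccoin : ∀ g, ∀ t ≤ 2 * r, (c g t).1 (coin g) = b g := by
    intro g t ht
    rw [hc, if_pos (hcB g), if_neg (by rw [hci]; omega)]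
  have hcu : ∀ g, ∀ t ≤ 2 * r, #{v ∈ B g | (c g t).1 v = u g} = t := by
    intro g t ht
    refine Eq.trans ?_ (card_index_lt (B g) (idx g) (hidx g) (himg g) t (by rw [hB]; omega))
    congr 1
    refine filter_congr fun v hv => ?_
    rw [hc, if_pos hv]
    by_cases h1 : idx g v < t
    · simp [h1]
    · simpa [h1] using (halt g v hv).2.2
  let β₀ : ι → ℕ → ℕ := fun g t => #{v ∈ (B g).erase (coin g) | t ≤ idx g v ∧ alt g v = b g}
  have hcb : ∀ g, ∀ t ≤ 2 * r, #{v ∈ B g | (c g t).1 v = b g} = β₀ g t + 1 := by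
    intro g t ht
    rw [← insert_erase (hcB g), filter_insert, if_pos (hccoin g t ht),
      card_insert_of_notMem (by simp)]
    congr 2
    refine filter_congr fun v hv => ?_
    rw [hc, if_pos (mem_of_mem_erase hv)]
    by_cases h1 : idx g v < t
    · simp [h1, (hbu g).symm, not_le.2 h1]
    · simp [h1, not_lt.1 h1]
  have hflip : ∀ (ω : ∀ g, Ωs g) g, ∀ t ≤ 2 * r, ω g = c g t →
      Φ (Function.update ω g (c' g t)) = Function.update (Φ ω) (coin g) (u g) := by
    intro ω g t ht hω
    funext v
    by_cases hv : ∃ g', v ∈ B g'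
    · obtain ⟨g', hg'⟩ := hv
      refine (hΦ1 _ g' v hg').trans ?_
      by_cases hgg : g' = g
      · subst hgg
        rw [Function.update_self]
        by_cases hvc : v = coin g'
        · subst hvc; simp [c']
        · rw [Function.update_of_ne hvc, hΦ1 ω g' v hg', hω]
          simp [c', hvc]
      · rw [Function.update_of_ne hgg]
        have hvc : v ≠ coin g := by rintro rfl; exact hdisj g' g hgg _ hg' (hcB g)
        rw [Function.update_of_ne hvc, hΦ1 ω g' v hg']
    · push Not at hv
      have hvc : v ≠ coin g := by rintro rfl; exact hv g (hcB g)
      rw [Function.update_of_ne hvc, hΦ0 ω v hv]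
      exact hΦ0 _ v hv
  have hisou : ∀ g g', g' ≠ g → ∀ v ∈ B g', u g ∉ allowed v := fun g g' hne v hv =>
    hsep g g' hne.symm _ (hu g) _ (hcB g) v hv (huB g _ (hcB g))
  have hisob : ∀ g g', g' ≠ g → ∀ v ∈ B g', b g ∉ allowed v := fun g g' hne v hv =>
    hsep g g' hne.symm _ (halt g _ (hcB g)).2.1 _ (hcB g) v hv (halt g _ (hcB g)).1
  have hmain := card_gadgets_le r k N s hr hN hcard c c' ?_ (fun g => base (u g))
    (fun g t => base (b g) + β₀ g t) ?_ (fun ω j => -(#{w | load h (Φ ω) w ≤ j} : ℤ))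
    (fun j => -((∑ k ∈ range (j + 1), M k : ℕ) : ℤ)) ?_ (Qm ^ (2 * r + 1)) hQ
  · refine le_trans ?_ (hmain.trans ?_)
    · rw [Nat.cast_le]
      have hsub : {a ∈ Fintype.piFinset allowed | ∀ k, #{u | load h a u = k} = M k} ⊆
          ({ω | ∀ j : ℕ, -(#{w | load h (Φ ω) w ≤ j} : ℤ) =
            -((∑ k ∈ range (j + 1), M k : ℕ) : ℤ)} : Finset (∀ g, Ωs g)).image Φ := by
        intro a ha
        obtain ⟨ha, haM⟩ := mem_filter.1 ha
        obtain ⟨ω, rfl⟩ := hΦsurj a ha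
        refine mem_image_of_mem _ (mem_filter.2 ⟨mem_univ _, fun j => ?_⟩)
        rw [card_level_le _ M haM]
      exact (card_le_card hsub).trans card_image_le
    · refine mul_le_mul_of_nonneg_left (by exact_mod_cast hcardΩ) ?_
      have := (one_sub_inv_two_mul_mem (Qm ^ (2 * r + 1))).1
      positivity
  · intro g t ht heq
    have h1 := congrArg (fun x : Ωs g => x.1 (coin g)) heq
    simp only [hccoin g t ht, c', Function.update_self] at h1
    exact hbu g h1
  · intro g t t' htt
    refine add_le_add_right (card_le_card ?_) _
    intro v hv
    simp only [mem_filter] at hv ⊢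
    exact ⟨hv.1, htt.trans hv.2.1, hv.2.2⟩
  · intro ω g t ht hω j
    simp only [hflip ω g t ht hω]
    have hΦc : Φ ω (coin g) = b g := by rw [hΦ1 ω g _ (hcB g), hω, hccoin g t ht]
    refine card_level_flip _ _ (u g) (b g) (hbu g) _ _ (fun w => ?_) ?_ ?_ j
    · have := load_update h (Φ ω) (coin g) (u g) w
      rw [hΦc] at this
      convert this
    · rw [hload ω g _ (hisou g), hω, hcu g t ht]
    · rw [hload ω g _ (hisob g), hω, hcb g t ht, ← add_assoc]

end Balls

section Balls

variable {S V : Type*} [Fintype S] [Fintype V]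

lemma exists_light_popular (allowed : S → Finset V) (light : V → Prop) (r q : ℕ)
    (hmin : ∀ v, q ≤ #{w ∈ allowed v | light w})
    (hr : 4 * r * Fintype.card V < Fintype.card S * q) (X : Finset S)
    (hX : 2 * #X ≤ Fintype.card S) :
    ∃ u, light u ∧ 2 * r + 1 ≤ #{v ∈ Xᶜ | u ∈ allowed v} := by
  by_contra! hcon
  have h1 := sum_card_bipartiteAbove_eq_sum_card_bipartiteBelow (s := Xᶜ)
    (t := (univ : Finset V)) (r := fun v u => u ∈ allowed v ∧ light u)
  have h2 : #Xᶜ * q ≤ ∑ v ∈ Xᶜ,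
      #(bipartiteAbove (fun v u => u ∈ allowed v ∧ light u) (univ : Finset V) v) := by
    rw [← smul_eq_mul]
    refine card_nsmul_le_sum _ _ _ fun v _ => (hmin v).trans (card_le_card fun w hw => ?_)
    simpa [bipartiteAbove] using hw
  have h3 : ∑ u, #(bipartiteBelow (fun v u => u ∈ allowed v ∧ light u) Xᶜ u) ≤
      Fintype.card V * (2 * r) := by
    rw [← smul_eq_mul, ← card_univ]
    refine sum_le_card_nsmul _ _ _ fun u _ => ?_
    by_cases hu : light u
    · have := hcon u hu
      refine le_trans (card_le_card fun v hv => ?_) (Nat.lt_succ_iff.1 this)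
      simp only [bipartiteBelow, mem_filter] at hv ⊢
      exact ⟨hv.1, hv.2.1⟩
    · refine le_trans (le_of_eq ?_) (Nat.zero_le _)
      simp [bipartiteBelow, hu]
  rw [card_compl] at h2
  have h4 : (Fintype.card S - #X) * q ≤ Fintype.card V * (2 * r) := by omega
  have h5 : Fintype.card S * q ≤ 2 * ((Fintype.card S - #X) * q) := by
    rw [← mul_assoc]
    exact Nat.mul_le_mul_right _ (by omega)
  nlinarith

lemma exists_separated_gadgets (allowed : S → Finset V) (light : V → Prop) (Λ r q Qm : ℕ)
    (hlight : ∀ u, light u → #{v | u ∈ allowed v} ≤ Λ) (hmax : ∀ v, #(allowed v) ≤ Qm)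
    (hmin : ∀ v, q ≤ #{w ∈ allowed v | light w})
    (hr : 4 * r * Fintype.card V < Fintype.card S * q) (G : ℕ)
    (hG : 2 * (G * ((2 * r + 1) * (Qm * Λ))) ≤ Fintype.card S) :
    ∃ P : Finset (V × Finset S), #P = G ∧
      (∀ g ∈ P, #g.2 = 2 * r + 1 ∧ light g.1 ∧ ∀ v ∈ g.2, g.1 ∈ allowed v) ∧
      ∀ g ∈ P, ∀ g' ∈ P, g ≠ g' → ∀ w, light w → ∀ v ∈ g.2, ∀ v' ∈ g'.2,
        w ∈ allowed v → w ∉ allowed v' := by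
  induction G with
  | zero => exact ⟨∅, by simp⟩
  | succ G ih =>
    obtain ⟨P, hP, hP1, hP2⟩ := ih ((Nat.mul_le_mul_left _
      (Nat.mul_le_mul_right _ (Nat.le_succ G))).trans hG)
    let X : Finset S := P.biUnion fun g => g.2.biUnion fun v =>
      {w ∈ allowed v | light w}.biUnion fun w => {v' | w ∈ allowed v'}
    have hX : #X ≤ G * ((2 * r + 1) * (Qm * Λ)) := by
      rw [← hP]
      refine card_biUnion_le_card_mul _ _ _ fun g hg => ?_
      rw [← (hP1 g hg).1]
      refine card_biUnion_le_card_mul _ _ _ fun v hv => ?_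
      refine (card_biUnion_le_card_mul _ _ Λ fun w hw => hlight w (mem_filter.1 hw).2).trans ?_
      exact Nat.mul_le_mul_right _ ((card_filter_le _ _).trans (hmax v))
    obtain ⟨u, hu, hcard⟩ := exists_light_popular allowed light r q hmin hr X
      ((Nat.mul_le_mul_left 2 hX).trans ((Nat.mul_le_mul_left _
        (Nat.mul_le_mul_right _ (Nat.le_succ G))).trans hG))
    obtain ⟨B, hBs, hBc⟩ := exists_subset_card_eq hcard
    have hB : ∀ v ∈ B, v ∉ X ∧ u ∈ allowed v := fun v hv => by simpa using hBs hv
    have hsep : ∀ g ∈ P, ∀ w, light w → ∀ v ∈ g.2, ∀ v' ∈ B, w ∈ allowed v → w ∉ allowed v' := by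
      intro g hg w hw v hv v' hv' hwv hwv'
      refine (hB v' hv').1 ?_
      simp only [X, mem_biUnion, mem_filter, mem_univ, true_and]
      exact ⟨g, hg, v, hv, w, ⟨hwv, hw⟩, hwv'⟩
    have hne : (u, B) ∉ P := by
      intro hmem
      obtain ⟨v, hv⟩ : B.Nonempty := card_pos.1 (by omega)
      exact hsep _ hmem u hu v hv v hv (hB v hv).2 (hB v hv).2
    refine ⟨insert (u, B) P, by rw [card_insert_of_notMem hne, hP], ?_, ?_⟩
    · intro g hg
      rcases mem_insert.1 hg with rfl | hg
      · exact ⟨hBc, hu, fun v hv => (hB v hv).2⟩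
      · exact hP1 g hg
    · intro g hg g' hg' hgg w hw v hv v' hv' hwv hwv'
      rcases mem_insert.1 hg with rfl | hg <;> rcases mem_insert.1 hg' with rfl | hg'
      · exact hgg rfl
      · exact hsep g' hg' w hw v' hv' v hv hwv' hwv
      · exact hsep g hg w hw v hv v' hv' hwv hwv'
      · exact hP2 g hg g' hg' hgg w hw v hv v' hv' hwv hwv'

lemma card_loads_light_le (allowed : S → Finset V) (h : V → ℕ) (M : ℕ → ℕ) (light : V → Prop)
    (Λ r k N s q Qm : ℕ) (hr1 : 1 ≤ r) (hN : 1 ≤ N) (hq : 2 ≤ q)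
    (hlight : ∀ u, light u → #{v | u ∈ allowed v} ≤ Λ) (hmax : ∀ v, #(allowed v) ≤ Qm)
    (hmin : ∀ v, q ≤ #{w ∈ allowed v | light w})
    (hr : 4 * r * Fintype.card V < Fintype.card S * q)
    (hG : 2 * (2 * (k * (r * N)) * ((2 * r + 1) * (Qm * Λ))) ≤ Fintype.card S) :
    (#{a ∈ Fintype.piFinset allowed | ∀ k, #{u | load h a u = k} = M k} : ℝ) ≤
      ((r * (2 ^ s * (1 - 1 / (2 * ((Qm ^ (2 * r + 1) : ℕ) : ℝ))) ^ N) + (1 / √(s + 1)) ^ r) +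
        (2 ^ s * (1 - 1 / (2 * ((Qm ^ (2 * r + 1) : ℕ) : ℝ))) ^ k + (1 / 2) ^ s)) *
        #(Fintype.piFinset allowed) := by
  obtain ⟨P, hP, hP1, hP2⟩ := exists_separated_gadgets allowed light Λ r q Qm hlight hmax hmin hr _
    hG
  let key : (S → V) → S → Option V := fun a v => if ∃ g ∈ P, v ∈ g.2 then none else some (a v)
  refine card_le_mul_of_fiberwise _ _ key _ ?_ (filter_subset _ _)
  intro b hb
  rw [Fintype.mem_piFinset] at hb
  let allowed' : S → Finset V := fun v => if ∃ g ∈ P, v ∈ g.2 then allowed v else {b v}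
  have hfib : {a ∈ Fintype.piFinset allowed | key a = key b} = Fintype.piFinset allowed' := by
    ext a
    simp only [mem_filter, Fintype.mem_piFinset, funext_iff, key, allowed', ← forall_and]
    refine forall_congr' fun v => ?_
    by_cases hv : ∃ g ∈ P, v ∈ g.2
    · simp only [if_pos hv, and_true]
    · simp only [if_neg hv, Option.some_inj, mem_singleton]
      exact ⟨fun hh => hh.2, fun hh => ⟨hh ▸ hb v, hh⟩⟩
  have hfib' : {a ∈ {a ∈ Fintype.piFinset allowed | ∀ k, #{u | load h a u = k} = M k} |
      key a = key b} = {a ∈ Fintype.piFinset allowed' | ∀ k, #{u | load h a u = k} = M k} := by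
    rw [← hfib, filter_filter, filter_filter]
    exact filter_congr fun a _ => and_comm
  have hsub : ∀ v, allowed' v ⊆ allowed v := by
    intro v
    simp only [allowed']
    split_ifs
    · exact Subset.rfl
    · simpa using hb v
  have hin : ∀ g : P, ∀ v ∈ g.1.2, allowed' v = allowed v := by
    intro g v hv
    simp only [allowed']
    rw [if_pos ⟨g.1, g.2, hv⟩]
  have := card_loads_local_le (ι := P) allowed' b h M r k N s Qm hr1 hN
    (by rw [Fintype.card_coe, hP]) (fun g => g.1.1) (fun g => g.1.2) light
    (fun v => (card_le_card (hsub v)).trans (hmax v))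
    (fun g v hv => by rw [hin g v hv]; exact hq.trans (hmin v))
    (fun g => (hP1 g.1 g.2).1)
    (fun g v hv => by rw [hin g v hv]; exact (hP1 g.1 g.2).2.2 v hv)
    (fun g => (hP1 g.1 g.2).2.1)
    (fun g g' hgg w hw v hv v' hv' hwv hwv' => hP2 g.1 g.2 g'.1 g'.2
      (fun h => hgg (Subtype.ext h)) w hw v hv v' hv' (hsub v hwv) (hsub v' hwv'))
    (fun v hv => by
      simp only [allowed']
      rw [if_neg]
      rintro ⟨g, hg, hvg⟩
      exact hv ⟨g, hg⟩ hvg)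
  rw [← hfib', ← hfib] at this
  convert this

end Balls

section Balls

variable {S V : Type*} [Fintype S]

lemma card_filter_piFinset (allowed : S → Finset V) (P : (S → V) → Prop) :
    #{a ∈ Fintype.piFinset allowed | P a} = #{a : ∀ v, allowed v | P fun v => a v} := by
  symm
  refine card_bij (fun a _ v => (a v : V)) ?_ ?_ ?_
  · intro a ha
    refine mem_filter.2 ⟨Fintype.mem_piFinset.2 fun v => (a v).2, (mem_filter.1 ha).2⟩
  · intro a _ b _ hab
    funext v
    exact Subtype.ext (congrFun hab v)
  · intro b hb
    obtain ⟨h1, h2⟩ := mem_filter.1 hb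
    exact ⟨fun v => ⟨b v, Fintype.mem_piFinset.1 h1 v⟩, mem_filter.2 ⟨mem_univ _, h2⟩, rfl⟩

lemma exists_disjoint_stars (allowed : S → Finset V) (D N : ℕ) (u : Fin D → V)
    (hheavy : ∀ j, D * N ≤ #{v | u j ∈ allowed v}) :
    ∃ f : Fin D × Fin N → S, Function.Injective f ∧ ∀ p, u p.1 ∈ allowed (f p) := by
  have := (all_card_le_biUnion_card_iff_exists_injective
    (fun p : Fin D × Fin N => ({v | u p.1 ∈ allowed v} : Finset S))).1 ?_
  · obtain ⟨f, hf, hf2⟩ := this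
    exact ⟨f, hf, fun p => by simpa using hf2 p⟩
  · intro s
    rcases s.eq_empty_or_nonempty with rfl | ⟨p, hp⟩
    · simp
    · refine (card_le_univ s).trans ?_
      rw [Fintype.card_prod, Fintype.card_fin, Fintype.card_fin]
      exact (hheavy p.1).trans (card_le_card (subset_biUnion_of_mem
        (fun p : Fin D × Fin N => ({v | u p.1 ∈ allowed v} : Finset S)) hp))

lemma card_loads_heavy_le [Fintype V] (allowed : S → Finset V) (h : V → ℕ) (M : ℕ → ℕ)
    (D N t W Q : ℕ)
    (hD : 0 < D) (hN : 0 < N) (ht : 0 < t) (u : Fin D → V) (hu : Function.Injective u)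
    (hheavy : ∀ j, D * N ≤ #{v | u j ∈ allowed v}) (hmin : ∀ v, D < #(allowed v))
    (hmax : ∀ v, #(allowed v) ≤ Q) (hW : ∑ w, h w + Fintype.card S ≤ W * t) :
    (#{a ∈ Fintype.piFinset allowed | ∀ k, #{u | load h a u = k} = M k} : ℝ) ≤
      (D * (2 ^ t * (1 - 1 / (2 * Q)) ^ N) +
        W ^ D * (D * (2 ^ t * (1 - 1 / (2 * Q)) ^ N) + (1 / √(t + 1)) ^ D)) *
        #(Fintype.piFinset allowed) := by
  obtain ⟨hq0, hq1⟩ := one_sub_inv_two_mul_mem Q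
  obtain ⟨f, hf, hfu⟩ := exists_disjoint_stars allowed D N u hheavy
  let κ : S → Fin D := Function.extend f Prod.fst fun _ => ⟨0, hD⟩
  have hκ : ∀ p, κ (f p) = p.1 := fun p => hf.extend_apply _ _ _
  let I : Finset S := univ.image f
  have hI : ∀ v ∈ I, ∃ p, f p = v := fun v hv => by simpa [I] using hv
  have hcl : ∀ j : Fin D, N ≤ #{v ∈ I | κ v = j} := by
    intro j
    have h1 : (univ : Finset (Fin N)).image (fun x => f (j, x)) ⊆ {v ∈ I | κ v = j} := by
      intro z hz
      obtain ⟨x, -, rfl⟩ := mem_image.1 hz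
      simp [I, hκ]
    refine le_trans (le_of_eq ?_) (card_le_card h1)
    rw [card_image_of_injective, card_univ, Fintype.card_fin]
    intro x x' h
    simpa using hf h
  have hIim : #(I.image κ) = D := by
    have : I.image κ = univ := by
      refine eq_univ_of_forall fun j => ?_
      refine mem_image.2 ⟨f (j, ⟨0, hN⟩), by simp [I], hκ _⟩
    rw [this, card_univ, Fintype.card_fin]
  have hex : ∀ v, ∃ w : allowed v, ∀ j, u j ≠ w := by
    intro v
    have : ∃ w ∈ allowed v, w ∉ univ.image u := by
      refine exists_mem_notMem_of_card_lt_card (lt_of_le_of_lt card_image_le ?_)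
      rw [card_univ, Fintype.card_fin]
      exact hmin v
    obtain ⟨w, hw, hw'⟩ := this
    exact ⟨⟨w, hw⟩, fun j hj => hw' (mem_image.2 ⟨j, mem_univ _, hj⟩)⟩
  choose c hc using hex
  have huI : ∀ v ∈ I, u (κ v) ∈ allowed v := by
    intro v hv
    obtain ⟨p, rfl⟩ := hI v hv
    rw [hκ]; exact hfu p
  have hex' : ∀ v, ∃ w : allowed v, v ∈ I → (w : V) = u (κ v) := by
    intro v
    by_cases hv : v ∈ I
    · exact ⟨⟨u (κ v), huI v hv⟩, fun _ => rfl⟩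
    · exact ⟨c v, fun h => absurd h hv⟩
  choose c' hc' using hex'
  let L : (∀ v, allowed v) → V → ℕ := fun a => load h fun v => (a v : V)
  have hLupd : ∀ a, ∀ v ∈ I, a v = c v → ∀ j,
      L (Function.update a v (c' v)) (u j) = L a (u j) + if j = κ v then 1 else 0 := by
    intro a v hv hav j
    have h1 := load_update h (fun v => (a v : V)) v (u (κ v)) (u j)
    rw [if_neg (by rw [hav]; exact hc v j), add_zero] at h1
    have h2 : (fun x => ((Function.update a v (c' v) x : allowed x) : V)) =
        Function.update (fun v => (a v : V)) v (u (κ v)) := by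
      funext x
      by_cases hx : x = v
      · subst hx; simp [hc' x hv]
      · simp [hx]
    simp only [L]
    rw [h2, h1]
    simp only [hu.eq_iff]
  set ε : ℝ := 2 ^ t * (1 - 1 / (2 * Q)) ^ N with hε
  have hε0 : 0 ≤ ε := by positivity
  set T : ℝ := ((Fintype.card (∀ v, allowed v) : ℕ) : ℝ) with hT
  have hcoin : ∀ m : Fin D → ℕ, (#{a | ∀ j, L a (u j) = m j} : ℝ) ≤
      (D * ε + (1 / √(t + 1)) ^ D) * T := by
    intro m
    have := card_coin_classes_le I κ c c' (fun v hv heq => hc v (κ v) (by rw [heq, hc' v hv]))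
      (fun a j => (L a (u j) : ℤ)) (fun j => (m j : ℤ))
      (fun a v hv hav j hj => by
        simp only [hLupd a v hv hav, hj.ne, if_false, add_zero])
      (fun a v hv hav => by
        simp only [hLupd a v hv hav, if_true]; push_cast; rfl)
      Q (fun v _ => by rw [Fintype.card_coe]; exact hmax v) N t (fun j _ => hcl j)
    rw [hIim] at this
    refine le_trans ?_ this
    exact_mod_cast card_le_card fun a ha => by
      simp only [mem_filter, mem_univ, true_and] at ha ⊢
      exact fun v _ => ha (κ v)
  have hbad : ∀ j, (#{a : ∀ v, allowed v | L a (u j) < t} : ℝ) ≤ ε * T := by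
    intro j
    have := card_few_hits_le {v ∈ I | κ v = j}
      (fun v => ({x | (x : V) = u j} : Finset (allowed v)))
      (fun v hv => by
        obtain ⟨hv1, rfl⟩ := mem_filter.1 hv
        exact ⟨⟨u (κ v), huI v hv1⟩, by simp⟩)
      Q (fun v _ => by rw [Fintype.card_coe]; exact hmax v) t
    refine le_trans ?_ (this.trans ?_)
    · refine Nat.cast_le.2 (card_le_card fun a ha => ?_)
      simp only [mem_filter, mem_univ, true_and, L, load] at ha ⊢
      refine lt_of_le_of_lt ?_ ha
      refine le_trans (card_le_card ?_) (Nat.le_add_left _ _)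
      intro v hv
      simp only [mem_filter, mem_univ, true_and] at hv ⊢
      exact hv.2
    · refine mul_le_mul_of_nonneg_right ?_ (Nat.cast_nonneg _)
      exact mul_le_mul_of_nonneg_left (pow_le_pow_of_le_one hq0 hq1 (hcl j)) (by positivity)
  have hcardT : (#(Fintype.piFinset allowed) : ℝ) = T := by
    rw [hT, Fintype.card_piFinset, Fintype.card_pi]
    simp
  rw [card_filter_piFinset, hcardT]
  set E : Finset (∀ v, allowed v) := {a | ∀ k, #{w | L a w = k} = M k} with hE
  change (#E : ℝ) ≤ _
  rcases E.eq_empty_or_nonempty with h0 | ⟨a₀, ha₀⟩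
  · rw [h0]; simp only [card_empty, Nat.cast_zero]; positivity
  let Vs : Finset ℕ := ({w | t ≤ L a₀ w} : Finset V).image (L a₀)
  have hVs : #Vs ≤ W := by
    refine card_image_le.trans ?_
    refine Nat.le_of_mul_le_mul_right (le_trans ?_ hW) ht
    rw [← sum_load h (fun v => (a₀ v : V)), ← smul_eq_mul]
    refine (card_nsmul_le_sum _ (L a₀) t fun w hw => (mem_filter.1 hw).2).trans ?_
    exact sum_le_sum_of_subset (subset_univ _)
  have hsub : E ⊆ (univ.biUnion fun j => ({a | L a (u j) < t} : Finset (∀ v, allowed v))) ∪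
      (Fintype.piFinset fun _ : Fin D => Vs).biUnion fun m => {a | ∀ j, L a (u j) = m j} := by
    intro a ha
    by_cases hb : ∃ j, L a (u j) < t
    · refine mem_union_left _ ?_
      simpa using hb
    · push Not at hb
      refine mem_union_right _ (mem_biUnion.2 ⟨fun j => L a (u j), ?_, by simp⟩)
      refine Fintype.mem_piFinset.2 fun j => ?_
      have h1 := (mem_filter.1 ha).2 (L a (u j))
      have h2 := (mem_filter.1 ha₀).2 (L a (u j))
      have h3 : 0 < #{w | L a₀ w = L a (u j)} := by
        rw [h2, ← h1]
        exact card_pos.2 ⟨u j, by simp⟩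
      obtain ⟨w, hw⟩ := card_pos.1 h3
      have hw : L a₀ w = L a (u j) := by simpa using hw
      refine mem_image.2 ⟨w, ?_, hw⟩
      rw [mem_filter, hw]
      exact ⟨mem_univ _, hb j⟩
  calc (#E : ℝ) ≤ ((∑ j, #{a : ∀ v, allowed v | L a (u j) < t} +
        ∑ m ∈ Fintype.piFinset fun _ : Fin D => Vs, #{a | ∀ j, L a (u j) = m j} : ℕ) : ℝ) :=
        Nat.cast_le.2 ((card_le_card hsub).trans ((card_union_le _ _).trans
          (add_le_add card_biUnion_le card_biUnion_le)))
    _ ≤ ∑ j : Fin D, ε * T + ∑ m ∈ Fintype.piFinset fun _ : Fin D => Vs,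
        (D * ε + (1 / √(t + 1)) ^ D) * T := by
        push_cast
        exact add_le_add (sum_le_sum fun j _ => hbad j) (sum_le_sum fun m _ => hcoin m)
    _ ≤ _ := by
        rw [sum_const, sum_const, card_univ, Fintype.card_fin, Fintype.card_piFinset, prod_const,
          card_univ, Fintype.card_fin, nsmul_eq_mul, nsmul_eq_mul]
        have h1 : (D * ε + W ^ D * (D * ε + (1 / √(t + 1)) ^ D)) * T =
            D * (ε * T) + W ^ D * ((D * ε + (1 / √(t + 1)) ^ D) * T) := by ring
        rw [h1]
        push_cast
        gcongr

end Balls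

lemma half_pow_le {x t : ℕ} (hx : 0 < x) (ht : x * x ≤ t) :
    (1 / 2 : ℝ) ^ t ≤ (1 / (x : ℝ)) ^ x := by
  have h3 : (1 / 2 : ℝ) ^ t ≤ (1 / 2) ^ (x * x) :=
    pow_le_pow_of_le_one (by norm_num) (by norm_num) ht
  have h4 : (1 / 2 : ℝ) ^ x ≤ 1 / x := by
    rw [one_div_pow]
    apply one_div_le_one_div_of_le (by exact_mod_cast hx)
    exact_mod_cast Nat.lt_two_pow_self.le
  refine h3.trans ?_
  rw [pow_mul]
  exact pow_le_pow_left₀ (by positivity) h4 _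

lemma two_pow_mul_pow_le {γ : ℝ} (h0 : 0 ≤ γ) {x t N : ℕ} (hx : 0 < x) (h : γ ^ x ≤ 1 / 4)
    (hN : N = x * t) (ht : x * x ≤ t) : 2 ^ t * γ ^ N ≤ (1 / (x : ℝ)) ^ x := by
  have h1 : (2 : ℝ) ^ t * γ ^ N = (2 * γ ^ x) ^ t := by rw [hN, mul_pow, ← pow_mul]
  have h2 : (2 * γ ^ x) ^ t ≤ (1 / 2 : ℝ) ^ t := by
    apply pow_le_pow_left₀ (by positivity); linarith
  rw [h1]
  exact h2.trans (half_pow_le hx ht)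

lemma one_div_sqrt_pow_le {x s r e : ℕ} (hx : 0 < x) (hs : s = (x ^ e) ^ 2) :
    (1 / √((s : ℝ) + 1)) ^ r ≤ (1 / (x : ℝ) ^ e) ^ r := by
  have hx' : (0 : ℝ) < x := by exact_mod_cast hx
  apply pow_le_pow_left₀ (by positivity)
  apply one_div_le_one_div_of_le (by positivity)
  apply Real.le_sqrt_of_sq_le
  rw [hs]; push_cast; linarith

lemma card_loads_le_of_card_le {S V : Type*} [Fintype S] [Fintype V] (allowed : S → Finset V)
    (h : V → ℕ) (M : ℕ → ℕ) (q D r x K : ℕ) (hr1 : 1 ≤ r) (hD2 : 2 ≤ D) (hDq : 2 * D ≤ q)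
    (hrD : 4 * r * K < D) (hxD : 12 * D + 1 ≤ x) (hxG : 4 * r * (2 * r + 1) * (2 * q) * K ≤ x)
    (hγ : (1 - 1 / (2 * (((2 * q) ^ (2 * r + 1) : ℕ) : ℝ))) ^ x ≤ 1 / 4)
    (hVS : Fintype.card V ≤ K * Fintype.card S) (hxV : x ^ 33 ≤ Fintype.card V)
    (hVx : Fintype.card V ≤ x ^ 34) (hSV : Fintype.card S ≤ Fintype.card V)
    (hh : ∑ u, h u ≤ 2 * Fintype.card V) (hmin : ∀ v, q ≤ #(allowed v))
    (hmax : ∀ v, #(allowed v) ≤ 2 * q) :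
    (#{a ∈ Fintype.piFinset allowed | ∀ k, #{u | load h a u = k} = M k} : ℝ) ≤
      4 * (1 / (x : ℝ)) ^ r * #(Fintype.piFinset allowed) := by
  have hx : 0 < x := by omega
  have hxR : (0 : ℝ) < x := by exact_mod_cast hx
  have hx1R : (1 : ℝ) ≤ x := by exact_mod_cast hx
  have hinv1 : 1 / (x : ℝ) ≤ 1 := by rw [div_le_one hxR]; exact hx1R
  have hinv0 : 0 ≤ 1 / (x : ℝ) := by positivity
  have hV0 : 0 < Fintype.card V := lt_of_lt_of_le (by positivity) hxV
  have hS0 : 0 < Fintype.card S := by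
    rcases Nat.eq_zero_or_pos (Fintype.card S) with h0 | h0
    · rw [h0] at hVS; omega
    · exact h0
  have hrD' : r ≤ D := by
    have : 1 ≤ K := by
      rcases Nat.eq_zero_or_pos K with h0 | h0
      · rw [h0] at hVS; omega
      · exact h0
    nlinarith
  set Λ : ℕ := x ^ 26 with hΛ
  let light : V → Prop := fun u => #{v | u ∈ allowed v} ≤ Λ
  have hsmall : ∀ m : ℕ, m + r ≤ x → (x : ℝ) ^ m * (1 / x) ^ x ≤ (1 / (x : ℝ)) ^ r := by
    intro m hm
    have : (1 / (x : ℝ)) ^ x ≤ (1 / x) ^ (m + r) := pow_le_pow_of_le_one hinv0 hinv1 (by omega)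
    calc (x : ℝ) ^ m * (1 / x) ^ x ≤ x ^ m * (1 / x) ^ (m + r) := by gcongr
      _ = (x * (1 / x)) ^ m * (1 / x) ^ r := by rw [pow_add, mul_pow]; ring
      _ = _ := by rw [mul_one_div_cancel hxR.ne', one_pow, one_mul]
  by_cases hc : D ≤ #{u | ¬ light u}
  · obtain ⟨T, hT, hTc⟩ := exists_subset_card_eq hc
    let u : Fin D → V := fun j => (T.equivFinOfCardEq hTc).symm j
    have hu : Function.Injective u := fun i j hij => by
      simpa [u] using Subtype.ext hij
    have hheavy : ∀ j, D * x ^ 25 ≤ #{v | u j ∈ allowed v} := by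
      intro j
      have h1 : u j ∈ ({u | ¬ light u} : Finset V) := hT ((T.equivFinOfCardEq hTc).symm j).2
      have h2 : Λ < #{v | u j ∈ allowed v} := by
        simpa [light] using (mem_filter.1 h1).2
      refine le_trans ?_ h2.le
      rw [hΛ, pow_succ x 25, mul_comm]
      exact Nat.mul_le_mul_left _ (by omega)
    have hW : ∑ w, h w + Fintype.card S ≤ x ^ 11 * x ^ 24 := by
      have : 3 * x ^ 34 ≤ x ^ 11 * x ^ 24 := by
        rw [← pow_add, show 11 + 24 = 34 + 1 from rfl, pow_succ, mul_comm]
        exact Nat.mul_le_mul_left _ (by omega)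
      omega
    have key := card_loads_heavy_le allowed h M D (x ^ 25) (x ^ 24) (x ^ 11) (2 * q) (by omega)
      (by positivity) (by positivity) u hu hheavy (fun v => by have := hmin v; omega) hmax hW
    refine key.trans (mul_le_mul_of_nonneg_right ?_ (by positivity))
    have hγ' : (1 - 1 / (2 * ((2 * q : ℕ) : ℝ))) ^ x ≤ 1 / 4 := by
      refine le_trans ?_ hγ
      refine pow_le_pow_left₀ (one_sub_inv_two_mul_mem (2 * q)).1 ?_ _
      have hq0 : 0 < 2 * q := by omega
      have : (((2 * q : ℕ) : ℝ)) ≤ (((2 * q) ^ (2 * r + 1) : ℕ) : ℝ) := by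
        exact_mod_cast Nat.le_self_pow (by omega) _
      have h0 : (0 : ℝ) < ((2 * q : ℕ) : ℝ) := by exact_mod_cast hq0
      gcongr
    have e1 : (2 : ℝ) ^ (x ^ 24) * (1 - 1 / (2 * ((2 * q : ℕ) : ℝ))) ^ (x ^ 25) ≤
        (1 / (x : ℝ)) ^ x :=
      two_pow_mul_pow_le (one_sub_inv_two_mul_mem (2 * q)).1 hx hγ' (by ring)
        (by rw [← pow_two]; exact Nat.pow_le_pow_right hx (by norm_num))
    have e2 := one_div_sqrt_pow_le (x := x) (s := x ^ 24) (r := D) (e := 12) hx (by ring)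
    have hDx : (D : ℝ) ≤ x := by exact_mod_cast (by omega : D ≤ x)
    have e3 : (D : ℝ) * (2 ^ (x ^ 24) * (1 - 1 / (2 * ((2 * q : ℕ) : ℝ))) ^ (x ^ 25)) ≤
        x * (1 / x) ^ x := by
      refine mul_le_mul hDx e1 ?_ hxR.le
      exact mul_nonneg (by positivity) (pow_nonneg (one_sub_inv_two_mul_mem (2 * q)).1 _)
    have s1 := hsmall 1 (by omega)
    have s2 := hsmall (11 * D + 1) (by omega)
    have s3 : ((x ^ 11 : ℕ) : ℝ) ^ D * (1 / (x : ℝ) ^ 12) ^ D ≤ (1 / (x : ℝ)) ^ r := by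
      have : ((x ^ 11 : ℕ) : ℝ) ^ D * (1 / (x : ℝ) ^ 12) ^ D = (1 / x) ^ D := by
        rw [← mul_pow]; congr 1; push_cast; field_simp
      rw [this]
      exact pow_le_pow_of_le_one hinv0 hinv1 hrD'
    calc _ ≤ x * (1 / x) ^ x +
          ((x ^ 11 : ℕ) : ℝ) ^ D * (x * (1 / x) ^ x + (1 / (x : ℝ) ^ 12) ^ D) := by
          gcongr
      _ = (x : ℝ) ^ 1 * (1 / x) ^ x + (x : ℝ) ^ (11 * D + 1) * (1 / x) ^ x +
          ((x ^ 11 : ℕ) : ℝ) ^ D * (1 / (x : ℝ) ^ 12) ^ D := by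
          push_cast; rw [pow_add, pow_mul]; ring
      _ ≤ (1 / (x : ℝ)) ^ r + (1 / (x : ℝ)) ^ r + (1 / (x : ℝ)) ^ r := by gcongr
      _ ≤ _ := by
          have : 0 ≤ (1 / (x : ℝ)) ^ r := by positivity
          linarith
  · push Not at hc
    have hminl : ∀ v, D ≤ #{w ∈ allowed v | light w} := by
      intro v
      have h1 := card_filter_add_card_filter_not (s := allowed v) (fun w => light w)
      have h2 : #{w ∈ allowed v | ¬ light w} ≤ #{u | ¬ light u} :=
        card_le_card (filter_subset_filter _ (subset_univ _))
      have := hmin v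
      have h3 : D ≤ #(allowed v) - #{w ∈ allowed v | ¬ light w} := by omega
      refine h3.trans (Nat.sub_le_of_le_add ?_)
      rw [← h1]
    have hr' : 4 * r * Fintype.card V < Fintype.card S * D := by
      calc 4 * r * Fintype.card V ≤ 4 * r * (K * Fintype.card S) := Nat.mul_le_mul_left _ hVS
        _ = Fintype.card S * (4 * r * K) := by ring
        _ < _ := Nat.mul_lt_mul_of_pos_left hrD hS0
    have hG : 2 * (2 * (x ^ 3 * (r * x ^ 3)) * ((2 * r + 1) * (2 * q * Λ))) ≤ Fintype.card S := by
      have hK : 0 < K := by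
        rcases Nat.eq_zero_or_pos K with h0 | h0
        · rw [h0] at hVS; omega
        · exact h0
      have h1 : K * (2 * (2 * (x ^ 3 * (r * x ^ 3)) * ((2 * r + 1) * (2 * q * Λ)))) ≤
          K * Fintype.card S := by
        calc _ = (4 * r * (2 * r + 1) * (2 * q) * K) * x ^ 32 := by rw [hΛ]; ring
          _ ≤ x * x ^ 32 := Nat.mul_le_mul_right _ hxG
          _ = x ^ 33 := by ring
          _ ≤ _ := hxV.trans hVS
      exact Nat.le_of_mul_le_mul_left h1 hK
    have key := card_loads_light_le allowed h M light Λ r (x ^ 3) (x ^ 3) (x ^ 2) D (2 * q) hr1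
      (Nat.one_le_pow _ _ hx) hD2 (fun u hu => hu) hmax
      (fun v => by convert hminl v) hr' hG
    refine key.trans (mul_le_mul_of_nonneg_right ?_ (by positivity))
    have e1 := two_pow_mul_pow_le (N := x ^ 3) (t := x ^ 2)
      (one_sub_inv_two_mul_mem ((2 * q) ^ (2 * r + 1))).1 hx hγ (by ring) (by rw [pow_two])
    have e2 := one_div_sqrt_pow_le (x := x) (s := x ^ 2) (r := r) (e := 1) hx (by ring)
    have e3 : (1 / 2 : ℝ) ^ (x ^ 2) ≤ (1 / x) ^ x := half_pow_le hx (by rw [pow_two])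
    rw [pow_one] at e2
    have s0 := hsmall 0 (by omega)
    have s1 := hsmall 1 (by omega)
    have hrx : (r : ℝ) ≤ x := by exact_mod_cast (by omega : r ≤ x)
    have hp : 0 ≤ (2 : ℝ) ^ x ^ 2 * (1 - 1 / (2 * (((2 * q) ^ (2 * r + 1) : ℕ) : ℝ))) ^ x ^ 3 :=
      mul_nonneg (by positivity) (pow_nonneg (one_sub_inv_two_mul_mem ((2 * q) ^ (2 * r + 1))).1 _)
    calc _ ≤ (x * (1 / x) ^ x + (1 / (x : ℝ)) ^ r) + ((1 / x) ^ x + (1 / x) ^ x) := by gcongr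
      _ = (x : ℝ) ^ 1 * (1 / x) ^ x + (1 / (x : ℝ)) ^ r +
          ((x : ℝ) ^ 0 * (1 / x) ^ x + (x : ℝ) ^ 0 * (1 / x) ^ x) := by ring
      _ ≤ (1 / (x : ℝ)) ^ r + (1 / (x : ℝ)) ^ r + ((1 / (x : ℝ)) ^ r + (1 / (x : ℝ)) ^ r) := by
          gcongr
      _ = _ := by ring

lemma card_filter_piFinset_le_of_split {S V : Type*} [Fintype S] (p : (S → V) → Prop) (β : ℝ)
    (q : ℕ) (hq : 0 < q)
    (H : ∀ allowed : S → Finset V, (∀ v, q ≤ #(allowed v)) → (∀ v, #(allowed v) ≤ 2 * q) →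
      (#{a ∈ Fintype.piFinset allowed | p a} : ℝ) ≤ β * #(Fintype.piFinset allowed))
    (allowed : S → Finset V) (hmin : ∀ v, q ≤ #(allowed v)) :
    (#{a ∈ Fintype.piFinset allowed | p a} : ℝ) ≤ β * #(Fintype.piFinset allowed) := by
  induction hm : ∑ v, #(allowed v) using Nat.strong_induction_on generalizing allowed with
  | _ m ih =>
  by_cases hmax : ∀ v, #(allowed v) ≤ 2 * q
  · exact H allowed hmin hmax
  push Not at hmax
  obtain ⟨v₀, hv₀⟩ := hmax
  obtain ⟨A, hA, hAc⟩ := exists_subset_card_eq (hmin v₀)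
  have hBc : #(allowed v₀ \ A) = #(allowed v₀) - q := by rw [card_sdiff_of_subset hA, hAc]
  have step : ∀ B ⊆ allowed v₀, q ≤ #B → #B < #(allowed v₀) →
      (#{a ∈ Fintype.piFinset (Function.update allowed v₀ B) | p a} : ℝ) ≤
        β * #(Fintype.piFinset (Function.update allowed v₀ B)) := by
    intro B hB hqB hlt
    refine ih _ ?_ _ ?_ rfl
    · rw [← hm]
      refine sum_lt_sum (fun v _ => ?_) ⟨v₀, mem_univ _, by simpa using hlt⟩
      by_cases hv : v = v₀
      · subst hv; simpa using hlt.le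
      · simp [hv]
    · intro v
      by_cases hv : v = v₀
      · subst hv; simpa using hqB
      · simpa [hv] using hmin v
  have hmem : ∀ B ⊆ allowed v₀, ∀ a, a ∈ Fintype.piFinset (Function.update allowed v₀ B) ↔
      a ∈ Fintype.piFinset allowed ∧ a v₀ ∈ B := by
    intro B hB a
    simp only [Fintype.mem_piFinset]
    constructor
    · intro h
      have h0 : a v₀ ∈ B := by simpa using h v₀
      refine ⟨fun v => ?_, h0⟩
      by_cases hv : v = v₀
      · subst hv; exact hB h0
      · simpa [hv] using h v
    · rintro ⟨h, h0⟩ v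
      by_cases hv : v = v₀
      · subst hv; simpa using h0
      · simpa [hv] using h v
  have h1 : ∀ P : (S → V) → Prop, #{a ∈ Fintype.piFinset allowed | P a} =
      #{a ∈ Fintype.piFinset (Function.update allowed v₀ A) | P a} +
        #{a ∈ Fintype.piFinset (Function.update allowed v₀ (allowed v₀ \ A)) | P a} := by
    intro P
    rw [← card_union_of_disjoint]
    · congr 1
      ext a
      simp only [mem_union, mem_filter, hmem A hA, hmem _ sdiff_subset, mem_sdiff]
      have : a ∈ Fintype.piFinset allowed → a v₀ ∈ allowed v₀ := fun h =>
        Fintype.mem_piFinset.1 h v₀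
      tauto
    · rw [Finset.disjoint_left]
      intro a ha hb
      simp only [mem_filter, hmem A hA, hmem _ sdiff_subset, mem_sdiff] at ha hb
      tauto
  have h2 := h1 (fun _ => True)
  simp only [filter_true] at h2
  have s1 := step A hA hAc.ge (by omega)
  have s2 := step (allowed v₀ \ A) sdiff_subset (by omega) (by omega)
  rw [h1 p, h2]
  push_cast
  linarith

lemma exists_root_bounds (x₀ : ℕ) : ∃ n₀ : ℕ, ∀ n ≥ n₀, ∃ x ≥ x₀, x ^ 33 ≤ n ∧ n ≤ x ^ 34 := by
  refine ⟨(x₀ + 2 ^ 33) ^ 33, fun n hn => ?_⟩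
  have h0 : x₀ + 2 ^ 33 ≤ n := (Nat.le_self_pow (by norm_num) _).trans hn
  have hle : x₀ + 2 ^ 33 ≤ Nat.findGreatest (fun x => x ^ 33 ≤ n) n := Nat.le_findGreatest h0 hn
  set x := Nat.findGreatest (fun x => x ^ 33 ≤ n) n with hx
  refine ⟨x, by omega, Nat.findGreatest_spec (P := fun x => x ^ 33 ≤ n) h0 hn, ?_⟩
  by_contra! hlt
  have hx1 : x + 1 ≤ n := by
    have : x ≤ x ^ 34 := Nat.le_self_pow (by norm_num) _
    omega
  have h1 := Nat.findGreatest_is_greatest (P := fun x => x ^ 33 ≤ n) (n := n) (k := x + 1)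
    (by omega) hx1
  apply h1
  have h2 : (x + 1) ^ 33 ≤ (2 * x) ^ 33 := Nat.pow_le_pow_left (by omega) _
  have h3 : (2 * x) ^ 33 ≤ x ^ 34 := by
    rw [mul_pow, pow_succ x 33, mul_comm]
    exact Nat.mul_le_mul_left _ (by omega)
  omega

theorem exists_card_loads_le (K q : ℕ) (hK : 0 < K) (hq : 16 * K ≤ q) :
    ∃ n₀ : ℕ, ∀ (S V : Type) [Fintype S] [Fintype V] (allowed : S → Finset V)
      (h : V → ℕ) (M : ℕ → ℕ), n₀ ≤ Fintype.card V → Fintype.card V ≤ K * Fintype.card S →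
      Fintype.card S ≤ Fintype.card V → ∑ u, h u ≤ 2 * Fintype.card V →
      (∀ v, q ≤ #(allowed v)) →
      (#{a ∈ Fintype.piFinset allowed | ∀ k, #{u | load h a u = k} = M k} : ℝ) ≤
        4 * (Fintype.card V : ℝ) ^ (-((q / (16 * K) : ℕ) / 34 : ℝ)) *
          #(Fintype.piFinset allowed) := by
  set r := q / (16 * K) with hr
  have hr1 : 1 ≤ r := by rw [hr, Nat.le_div_iff_mul_le (by omega)]; omega
  have hrq : r * (16 * K) ≤ q := Nat.div_mul_le_self _ _
  have hγ1 : 1 - 1 / (2 * (((2 * q) ^ (2 * r + 1) : ℕ) : ℝ)) < 1 := by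
    have : (0 : ℝ) < (((2 * q) ^ (2 * r + 1) : ℕ) : ℝ) := by
      exact_mod_cast Nat.pow_pos (by omega)
    have : 0 < 1 / (2 * (((2 * q) ^ (2 * r + 1) : ℕ) : ℝ)) := by positivity
    linarith
  have hlim := tendsto_pow_atTop_nhds_zero_of_lt_one
    (one_sub_inv_two_mul_mem ((2 * q) ^ (2 * r + 1))).1 hγ1
  obtain ⟨x₁, hx₁⟩ := Filter.eventually_atTop.1
    (hlim.eventually_le_const (by norm_num : (0 : ℝ) < 1 / 4))
  obtain ⟨n₀, hn₀⟩ := exists_root_bounds (x₁ + 12 * (q / 2) + 1 + 4 * r * (2 * r + 1) * (2 * q) * K)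
  refine ⟨n₀, fun S V _ _ allowed h M hn hVS hSV hh hmin => ?_⟩
  obtain ⟨x, hx, hx33, hx34⟩ := hn₀ _ hn
  have hx0 : (0 : ℝ) < x := by exact_mod_cast (by omega : 0 < x)
  refine (card_filter_piFinset_le_of_split _ (4 * (1 / (x : ℝ)) ^ r) q (by omega)
    (fun al h1 h2 => ?_) allowed hmin).trans ?_
  · exact card_loads_le_of_card_le al h M q (q / 2) r x K hr1 (by omega) (by omega)
      (by have : 4 * r * K * 4 ≤ q := by linarith
          omega) (by omega) (by omega) (hx₁ x (by omega)) hVS hx33 hx34 hSV hh h1 h2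
  · gcongr
    have hV0 : (0 : ℝ) < Fintype.card V := by
      have : 0 < x ^ 33 := Nat.pow_pos (by omega)
      exact_mod_cast this.trans_le hx33
    rw [one_div, inv_pow, Real.rpow_neg hV0.le]
    gcongr
    calc (Fintype.card V : ℝ) ^ ((r : ℝ) / 34) ≤ ((x : ℝ) ^ (34 : ℕ)) ^ ((r : ℝ) / 34) := by
          gcongr
          exact_mod_cast hx34
      _ = x ^ r := by
          rw [← Real.rpow_natCast, ← Real.rpow_mul hx0.le, ← Real.rpow_natCast]
          congr 1; push_cast; ring

noncomputable def dg {V : Type*} [Fintype V] (H : SimpleGraph V) (u : V) : ℕ := #{w | H.Adj u w}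

lemma dg_eq_degree {V : Type*} [Fintype V] (H : SimpleGraph V) (u : V) [Fintype (H.neighborSet u)] :
    dg H u = H.degree u := by
  rw [dg, ← SimpleGraph.card_neighborFinset_eq_degree]
  congr 1; ext w; simp

lemma sum_dg_eq {V : Type*} [Fintype V] {H : SimpleGraph V} (hH : H.IsTree) :
    ∑ u, dg H u + 2 = 2 * Fintype.card V := by
  have h1 := H.sum_degrees_eq_twice_card_edges
  have h2 := hH.card_edgeFinset
  have h3 : ∑ u, dg H u = ∑ u, H.degree u := sum_congr rfl fun u _ => dg_eq_degree H u
  omega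

lemma isTree_of_sum_dg {V : Type*} [Fintype V] {H : SimpleGraph V} (hH : H.Connected)
    (h : ∑ u, dg H u + 2 = 2 * Fintype.card V) : H.IsTree := by
  rw [SimpleGraph.isTree_iff_connected_and_card]
  refine ⟨hH, ?_⟩
  have h1 := H.sum_degrees_eq_twice_card_edges
  have h3 : ∑ u, dg H u = ∑ u, H.degree u := sum_congr rfl fun u _ => dg_eq_degree H u
  rw [Nat.card_eq_fintype_card, Nat.card_eq_fintype_card, ← SimpleGraph.edgeFinset_card]
  omega

lemma dg_eq_one_iff {V : Type*} [Fintype V] {H : SimpleGraph V} {u : V} :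
    dg H u = 1 ↔ ∃ z, ∀ w, H.Adj u w ↔ w = z := by
  rw [dg, card_eq_one]
  simp [Finset.ext_iff]

section Attach
variable {V : Type*}

def core (H : SimpleGraph V) (S : Finset V) : SimpleGraph V where
  Adj x y := H.Adj x y ∧ x ∉ S ∧ y ∉ S
  symm := ⟨fun _ _ h => ⟨h.1.symm, h.2.2, h.2.1⟩⟩
  loopless := ⟨fun _ h => h.1.ne rfl⟩

lemma core_adj {H : SimpleGraph V} {S : Finset V} {x y : V} :
    (core H S).Adj x y ↔ H.Adj x y ∧ x ∉ S ∧ y ∉ S := Iff.rfl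

def attach (K : SimpleGraph V) (S : Finset V) (a : S → V) : SimpleGraph V :=
  K ⊔ SimpleGraph.fromRel fun x y => ∃ h : x ∈ S, a ⟨x, h⟩ = y

variable {K : SimpleGraph V} {S A : Finset V} {a : S → V}

lemma attach_adj_of_mem (hSA : Disjoint S A) (hK : ∀ x y, K.Adj x y → x ∉ S)
    (ha : ∀ v, a v ∈ A) (v : S) (w : V) : (attach K S a).Adj v w ↔ w = a v := by
  rw [attach, SimpleGraph.sup_adj, SimpleGraph.fromRel_adj]
  constructor
  · rintro (h | ⟨-, ⟨h, h'⟩ | ⟨h, h'⟩⟩)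
    · exact absurd v.2 (hK _ _ h)
    · exact h'.symm
    · exact absurd (h' ▸ ha _) (Finset.disjoint_left.1 hSA v.2)
  · rintro rfl
    refine Or.inr ⟨fun h => ?_, Or.inl ⟨v.2, rfl⟩⟩
    exact Finset.disjoint_left.1 hSA v.2 (h ▸ ha v)

lemma attach_adj_of_notMem {x y : V} (hx : x ∉ S) (hy : y ∉ S) :
    (attach K S a).Adj x y ↔ K.Adj x y := by
  simp [attach, hx, hy]

lemma dg_attach [Fintype V] (hSA : Disjoint S A) (hK : ∀ x y, K.Adj x y → x ∉ S)
    (ha : ∀ v, a v ∈ A) (u : V) :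
    dg (attach K S a) u = load (fun u => dg K u + if u ∈ S then 1 else 0) a u := by
  rw [load]
  by_cases hu : u ∈ S
  · have h1 : dg (attach K S a) u = 1 :=
      dg_eq_one_iff.2 ⟨a ⟨u, hu⟩, attach_adj_of_mem hSA hK ha ⟨u, hu⟩⟩
    have h2 : dg K u = 0 := by
      rw [dg, card_eq_zero, filter_eq_empty_iff]
      exact fun w _ h => hK _ _ h hu
    have h3 : #{v | a v = u} = 0 := by
      rw [card_eq_zero, filter_eq_empty_iff]
      rintro v - rfl
      exact Finset.disjoint_left.1 hSA hu (ha v)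
    rw [h1, h2, h3, if_pos hu]
  · rw [if_neg hu, add_zero, dg, dg]
    have : univ.filter (fun w => (attach K S a).Adj u w) =
        univ.filter (fun w => K.Adj u w) ∪ (univ.filter fun v => a v = u).image Subtype.val := by
      ext w
      simp only [mem_filter, mem_univ, true_and, mem_union, mem_image]
      by_cases hw : w ∈ S
      · rw [SimpleGraph.adj_comm, attach_adj_of_mem hSA hK ha ⟨w, hw⟩]
        constructor
        · rintro rfl
          exact Or.inr ⟨_, rfl, rfl⟩
        · rintro (h | ⟨v, rfl, rfl⟩)
          · exact absurd hw (hK _ _ h.symm)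
          · rfl
      · rw [attach_adj_of_notMem hu hw]
        constructor
        · exact Or.inl
        · rintro (h | ⟨v, -, rfl⟩)
          · exact h
          · exact absurd v.2 hw
    rw [this, card_union_of_disjoint, card_image_of_injective _ Subtype.val_injective]
    rw [Finset.disjoint_left]
    intro w hw hw'
    obtain ⟨v, -, rfl⟩ := mem_image.1 hw'
    exact hK _ _ (mem_filter.1 hw).2.symm v.2

lemma core_attach (hK : ∀ x y, K.Adj x y → x ∉ S) : core (attach K S a) S = K := by
  ext x y
  rw [core_adj]
  constructor
  · rintro ⟨h, hx, hy⟩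
    exact (attach_adj_of_notMem hx hy).1 h
  · intro h
    have hx := hK _ _ h
    have hy := hK _ _ h.symm
    exact ⟨(attach_adj_of_notMem hx hy).2 h, hx, hy⟩

lemma attach_injective (hSA : Disjoint S A) (hK : ∀ x y, K.Adj x y → x ∉ S) {b : S → V}
    (ha : ∀ v, a v ∈ A) (hb : ∀ v, b v ∈ A) (h : attach K S a = attach K S b) : a = b := by
  funext v
  rw [← attach_adj_of_mem hSA hK hb v, ← h, attach_adj_of_mem hSA hK ha]

lemma attach_core {H : SimpleGraph V} (hSA : Disjoint S A) (ha : ∀ v, a v ∈ A)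
    (hH : ∀ (v : S) w, H.Adj v w ↔ w = a v) : attach (core H S) S a = H := by
  have hK : ∀ x y, (core H S).Adj x y → x ∉ S := fun x y h => h.2.1
  ext x y
  by_cases hx : x ∈ S
  · rw [attach_adj_of_mem hSA hK ha ⟨x, hx⟩, ← hH]
  by_cases hy : y ∈ S
  · rw [SimpleGraph.adj_comm, attach_adj_of_mem hSA hK ha ⟨y, hy⟩, ← hH, SimpleGraph.adj_comm]
  · rw [attach_adj_of_notMem hx hy, core_adj]
    tauto

lemma connected_attach {b : S → V} (hSA : Disjoint S A) (hK : ∀ x y, K.Adj x y → x ∉ S)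
    (ha : ∀ v, a v ∈ A) (hb : ∀ v, b v ∈ A) (h : (attach K S a).Connected) :
    (attach K S b).Connected := by
  have hA : ∀ x ∈ A, x ∉ S := fun x hx hx' => Finset.disjoint_left.1 hSA hx' hx
  let ρ : V → V := fun x => if hx : x ∈ S then a ⟨x, hx⟩ else x
  have h1 : ∀ x y, (attach K S a).Adj x y → (attach K S b).Reachable (ρ x) (ρ y) := by
    intro x y hxy
    by_cases hx : x ∈ S
    · rw [attach_adj_of_mem hSA hK ha ⟨x, hx⟩] at hxy
      have hy : y ∉ S := hxy ▸ hA _ (ha _)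
      have e : ρ x = ρ y := by simp only [ρ, dif_pos hx, dif_neg hy]; exact hxy.symm
      rw [e]
    by_cases hy : y ∈ S
    · rw [SimpleGraph.adj_comm, attach_adj_of_mem hSA hK ha ⟨y, hy⟩] at hxy
      have e : ρ x = ρ y := by simp only [ρ, dif_pos hy, dif_neg hx]; exact hxy
      rw [e]
    · simp only [ρ, dif_neg hx, dif_neg hy]
      exact ((attach_adj_of_notMem hx hy).2 ((attach_adj_of_notMem hx hy).1 hxy)).reachable
  have h2 : ∀ x y, (attach K S a).Reachable x y → (attach K S b).Reachable (ρ x) (ρ y) := by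
    rintro x y ⟨p⟩
    induction p with
    | nil => rfl
    | cons hadj _ ih => exact (h1 _ _ hadj).trans ih
  have h3 : ∀ x, ∃ y, y ∉ S ∧ (attach K S b).Reachable x y := by
    intro x
    by_cases hx : x ∈ S
    · exact ⟨b ⟨x, hx⟩, hA _ (hb _),
        ((attach_adj_of_mem hSA hK hb ⟨x, hx⟩ _).2 rfl).reachable⟩
    · exact ⟨x, hx, by rfl⟩
  have := h.nonempty
  refine SimpleGraph.Connected.mk fun x y => ?_
  obtain ⟨x', hx', hx⟩ := h3 x
  obtain ⟨y', hy', hy⟩ := h3 y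
  have := h2 x' y' (h.preconnected _ _)
  simp only [ρ, dif_neg hx', dif_neg hy'] at this
  exact hx.trans (this.trans hy.symm)

end Attach

section Fiber
variable {V : Type} [Fintype V]

noncomputable def trees (G : SimpleGraph V) : Finset (SimpleGraph V) :=
  univ.filter fun H => H ≤ G ∧ H.IsTree

lemma mem_trees {G H : SimpleGraph V} : H ∈ trees G ↔ H ≤ G ∧ H.IsTree := by simp [trees]

noncomputable def sel (G : SimpleGraph V) (A : Finset V) (q : ℕ) (H : SimpleGraph V) : Finset V :=
  univ.filter fun y => y ∉ A ∧ dg H y = 1 ∧ (∃ z ∈ A, H.Adj y z) ∧ q ≤ #{w ∈ A | G.Adj y w}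

variable {G H : SimpleGraph V} {A : Finset V} {q : ℕ}

lemma mem_sel {y : V} : y ∈ sel G A q H ↔
    y ∉ A ∧ dg H y = 1 ∧ (∃ z ∈ A, H.Adj y z) ∧ q ≤ #{w ∈ A | G.Adj y w} := by simp [sel]

lemma disjoint_sel {S : Finset V} (hS : sel G A q H = S) : Disjoint S A :=
  hS ▸ Finset.disjoint_left.2 fun _ h => (mem_sel.1 h).1

lemma exists_attach_sel {S : Finset V} (hS : sel G A q H = S) (hH : H ≤ G) :
    ∃ a : S → V, (∀ v, a v ∈ A ∧ G.Adj v (a v)) ∧ ∀ (v : S) w, H.Adj v w ↔ w = a v := by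
  subst hS
  have h : ∀ v : sel G A q H, ∃ z, (z ∈ A ∧ G.Adj v z) ∧ ∀ w, H.Adj v w ↔ w = z := by
    rintro ⟨v, hv⟩
    obtain ⟨-, h1, ⟨z, hz, hvz⟩, -⟩ := mem_sel.1 hv
    obtain ⟨z', hz'⟩ := dg_eq_one_iff.1 h1
    obtain rfl := (hz' z).1 hvz
    exact ⟨z, ⟨hz, hH hvz⟩, hz'⟩
  choose a ha using h
  exact ⟨a, fun v => (ha v).1, fun v => (ha v).2⟩

lemma attach_mem_trees {S : Finset V} (hS : sel G A q H = S) (hH : H ∈ trees G) {a : S → V}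
    (ha : ∀ v, a v ∈ A ∧ G.Adj v (a v)) : attach (core H S) S a ∈ trees G := by
  obtain ⟨hHG, hT⟩ := mem_trees.1 hH
  obtain ⟨a₀, ha₀, hHa⟩ := exists_attach_sel hS hHG
  have hK : ∀ x y, (core H S).Adj x y → x ∉ S := fun x y h => h.2.1
  have h0 : attach (core H S) S a₀ = H := attach_core (disjoint_sel hS) (fun v => (ha₀ v).1) hHa
  rw [mem_trees]
  constructor
  · refine sup_le (fun x y h => hHG h.1) fun x y h => ?_
    obtain ⟨-, ⟨hx, rfl⟩ | ⟨hx, rfl⟩⟩ := (SimpleGraph.fromRel_adj _ _ _).1 h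
    · exact (ha ⟨x, hx⟩).2
    · exact (ha ⟨y, hx⟩).2.symm
  · refine isTree_of_sum_dg (connected_attach (a := a₀) (disjoint_sel hS) hK (fun v => (ha₀ v).1)
      (fun v => (ha v).1) (h0.symm ▸ hT.connected)) ?_
    rw [← sum_dg_eq hT]
    congr 1
    calc _ = ∑ u, load (fun u => dg (core H S) u + if u ∈ S then 1 else 0) a u :=
          sum_congr rfl fun u _ => dg_attach (disjoint_sel hS) hK (fun v => (ha v).1) u
      _ = ∑ u, load (fun u => dg (core H S) u + if u ∈ S then 1 else 0) a₀ u := by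
          rw [sum_load, sum_load]
      _ = ∑ u, dg (attach (core H S) S a₀) u :=
          sum_congr rfl fun u _ => (dg_attach (disjoint_sel hS) hK (fun v => (ha₀ v).1) u).symm
      _ = _ := by rw [h0]

lemma sel_attach {S : Finset V} (hS : sel G A q H = S) (hHG : H ≤ G) {a : S → V}
    (ha : ∀ v, a v ∈ A ∧ G.Adj v (a v)) : sel G A q (attach (core H S) S a) = S := by
  obtain ⟨a₀, ha₀, hHa⟩ := exists_attach_sel hS hHG
  have hK : ∀ x y, (core H S).Adj x y → x ∉ S := fun x y h => h.2.1
  have h0 : attach (core H S) S a₀ = H := attach_core (disjoint_sel hS) (fun v => (ha₀ v).1) hHa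
  have hadj := attach_adj_of_mem (disjoint_sel hS) hK (fun v => (ha v).1)
  ext y
  constructor
  · intro hy
    by_contra hyS
    obtain ⟨h1, h2, ⟨z, hz, hyz⟩, h3⟩ := mem_sel.1 hy
    have hzS : z ∉ S := fun h => Finset.disjoint_left.1 (disjoint_sel hS) h hz
    have hno : ∀ b : S → V, (∀ v, b v ∈ A) → dg (attach (core H S) S b) y = dg (core H S) y := by
      intro b hb
      rw [dg_attach (disjoint_sel hS) hK hb, load, if_neg hyS, add_zero, Nat.add_eq_left,
        card_eq_zero, filter_eq_empty_iff]
      rintro v - rfl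
      exact h1 (hb v)
    refine hyS (hS ▸ mem_sel.2 ⟨h1, ?_, ⟨z, hz, ?_⟩, h3⟩)
    · rw [← h0, hno a₀ fun v => (ha₀ v).1, ← hno a fun v => (ha v).1, h2]
    · exact ((attach_adj_of_notMem hyS hzS).1 hyz).1
  · intro hy
    obtain ⟨h1, -, -, h3⟩ := mem_sel.1 (hS ▸ hy)
    refine mem_sel.2 ⟨h1, dg_eq_one_iff.2 ⟨_, hadj ⟨y, hy⟩⟩, ⟨_, (ha ⟨y, hy⟩).1, ?_⟩, h3⟩
    exact (hadj ⟨y, hy⟩ _).2 rfl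

lemma histogram_eq_of_iso {H H' : SimpleGraph V} (e : H ≃g H') (k : ℕ) :
    #{u | dg H u = k} = #{u | dg H' u = k} := by
  have h : ∀ u, dg H u = dg H' (e u) := fun u => by
    rw [dg, dg]
    refine card_equiv e.toEquiv fun w => ?_
    simp [SimpleGraph.Iso.map_adj_iff]
  refine card_equiv e.toEquiv fun u => ?_
  simp [h]

theorem exists_card_iso_sel_le (K q : ℕ) (hK : 0 < K) (hq : 16 * K ≤ q) :
    ∃ n₀ : ℕ, ∀ (V : Type) [Fintype V] (G : SimpleGraph V) (A : Finset V) (W : Type)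
      (T : SimpleGraph W), n₀ ≤ Fintype.card V →
      (#{H ∈ trees G | Nonempty (H ≃g T) ∧ Fintype.card V ≤ K * #(sel G A q H)} : ℝ) ≤
        4 * (Fintype.card V : ℝ) ^ (-((q / (16 * K) : ℕ) / 34 : ℝ)) * #(trees G) := by
  obtain ⟨n₀, hn₀⟩ := exists_card_loads_le K q hK hq
  refine ⟨n₀, fun V _ G A W T hn => ?_⟩
  refine card_le_mul_of_fiberwise (trees G) _ (fun H => (sel G A q H, core H (sel G A q H))) _ ?_
    (filter_subset _ _)
  intro b hb
  generalize hE : @filter (SimpleGraph V) _ (_) (@filter (SimpleGraph V) _ (_) _) = E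
  rcases E.eq_empty_or_nonempty with h0 | ⟨H₁, hH₁⟩
  · rw [h0]
    simp only [card_empty, Nat.cast_zero]
    positivity
  simp only [← hE, mem_filter, Prod.mk.injEq] at hH₁
  obtain ⟨⟨-, ⟨e₁⟩, hcard⟩, hsel, -⟩ := hH₁
  obtain ⟨S, hS⟩ : ∃ S, sel G A q b = S := ⟨_, rfl⟩
  rw [hsel, hS] at hcard
  rw [hS] at hE ⊢
  obtain ⟨hbG, hbT⟩ := mem_trees.1 hb
  obtain ⟨a₀, ha₀, hba₀⟩ := exists_attach_sel hS hbG
  have hK' : ∀ x y, (core b S).Adj x y → x ∉ S := fun x y h => h.2.1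
  have h0 : attach (core b S) S a₀ = b := attach_core (disjoint_sel hS) (fun v => (ha₀ v).1) hba₀
  let allowed : S → Finset V := fun v => {w ∈ A | G.Adj v w}
  let h : V → ℕ := fun u => dg (core b S) u + if u ∈ S then 1 else 0
  have hall : ∀ a, a ∈ Fintype.piFinset allowed ↔ ∀ v, a v ∈ A ∧ G.Adj v (a v) := by
    intro a
    simp [allowed, Fintype.mem_piFinset]
  have hmain := hn₀ S V allowed h (fun k => #{u | dg H₁ u = k}) hn
    (by rwa [Fintype.card_coe]) (card_le_univ S |>.trans' (by rw [Fintype.card_coe])) ?_ ?_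
  rotate_left
  · have h1 : ∑ u, dg b u = ∑ u, load h a₀ u := sum_congr rfl fun u _ => by
      rw [← dg_attach (disjoint_sel hS) hK' (fun v => (ha₀ v).1), h0]
    rw [sum_load] at h1
    have := sum_dg_eq hbT
    omega
  · exact fun v => (mem_sel.1 (hS ▸ v.2 : (v : V) ∈ sel G A q b)).2.2.2
  have hmain' : (#{a ∈ Fintype.piFinset allowed | ∀ k, #{u | load h a u = k} =
      #{u | dg H₁ u = k}} : ℝ) ≤ 4 * (Fintype.card V : ℝ) ^ (-((q / (16 * K) : ℕ) / 34 : ℝ)) *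
        #(Fintype.piFinset allowed) := by convert hmain
  have hle : #E ≤
      #{a ∈ Fintype.piFinset allowed | ∀ k, #{u | load h a u = k} = #{u | dg H₁ u = k}} := by
    refine le_trans (card_le_card (t := image (attach (core b S) S) _) ?_) card_image_le
    intro H hH
    simp only [← hE, mem_filter, Prod.mk.injEq] at hH
    obtain ⟨⟨hHt, ⟨e⟩, -⟩, hHS, hHc⟩ := hH
    rw [hHS] at hHc
    obtain ⟨a, ha, hHa⟩ := exists_attach_sel hHS (mem_trees.1 hHt).1
    have hatt : attach (core b S) S a = H := by
      rw [← hHc]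
      exact attach_core (disjoint_sel hS) (fun v => (ha v).1) hHa
    refine mem_image.2 ⟨a, mem_filter.2 ⟨(hall a).2 ha, fun k => ?_⟩, hatt⟩
    rw [← histogram_eq_of_iso (e.trans e₁.symm) k]
    congr 1
    ext u
    rw [mem_filter, mem_filter, ← dg_attach (disjoint_sel hS) hK' (fun v => (ha v).1), hatt]
  have hge : #(Fintype.piFinset allowed) ≤
      #{H ∈ trees G | (sel G A q H, core H (sel G A q H)) = (S, core b S)} := by
    refine card_le_card_of_injOn (attach (core b S) S) ?_ ?_
    · intro a ha
      have ha' := (hall a).1 ha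
      have h1 : sel G A q (attach (core b S) S a) = S := sel_attach hS hbG ha'
      simp only [coe_filter, Set.mem_ofPred_eq, Prod.mk.injEq]
      refine ⟨attach_mem_trees hS hb ha', h1, ?_⟩
      rw [h1, core_attach hK']
    · intro a ha a' ha' heq
      exact attach_injective (disjoint_sel hS) hK' (fun v => ((hall a).1 ha v).1)
        (fun v => ((hall a').1 ha' v).1) heq
  refine (Nat.cast_le.2 hle).trans (hmain'.trans ?_)
  exact mul_le_mul_of_nonneg_left (Nat.cast_le.2 (by convert hge)) (by positivity)

end Fiber

section Average
variable {V : Type} [Fintype V] {G H : SimpleGraph V}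

noncomputable def leaves (H : SimpleGraph V) : Finset V := univ.filter fun y => dg H y = 1

lemma two_pow_le_card_mem_sel (hHG : H ≤ G) (q : ℕ) {y : V} (hq : 2 * q ≤ dg G y)
    (hy : y ∈ leaves H) : 2 ^ Fintype.card V ≤ 8 * #{A | y ∈ sel G A q H} := by
  have hy1 : dg H y = 1 := by simpa [leaves] using hy
  obtain ⟨z, hz⟩ := dg_eq_one_iff.1 hy1
  have hyz : H.Adj y z := (hz z).2 rfl
  let B : Finset V := ({w | G.Adj y w} : Finset V).erase z
  have hB : #B + 1 = dg G y := card_erase_add_one (by simpa using hHG hyz)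
  have hBmem : ∀ w, w ∈ B ↔ w ≠ z ∧ G.Adj y w := fun w => by simp [B]
  let tog : Finset V → Prop := fun A => #{w ∈ B | w ∈ A} + 1 < q
  let φ : Finset V → Finset V := fun A =>
    {w | w = z ∨ (w ≠ y ∧ (w ∈ A ↔ ¬ (w ∈ B ∧ tog A)))}
  have hφ : ∀ A w, w ∈ φ A ↔ w = z ∨ (w ≠ y ∧ (w ∈ A ↔ ¬ (w ∈ B ∧ tog A))) := fun A w => by
    simp [φ]
  have hgood : ∀ A, y ∈ sel G (φ A) q H := by
    intro A
    refine mem_sel.2 ⟨?_, hy1, ⟨z, (hφ _ _).2 (Or.inl rfl), hyz⟩, ?_⟩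
    · rw [hφ]
      rintro (h | h)
      · exact hyz.ne h
      · exact h.1 rfl
    · have key : ∀ C ⊆ B, (∀ w ∈ C, w ∈ A ↔ ¬ tog A) → #C + 1 ≤ #{w ∈ φ A | G.Adj y w} := by
        intro C hC hCA
        have hzC : z ∉ C := fun h => ((hBmem z).1 (hC h)).1 rfl
        rw [← card_insert_of_notMem hzC]
        refine card_le_card fun w hw => ?_
        rw [mem_filter, hφ]
        rcases mem_insert.1 hw with rfl | hw
        · exact ⟨Or.inl rfl, hHG hyz⟩
        · have h1 := (hBmem w).1 (hC hw)
          have h2 := hCA w hw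
          have h3 := hC hw
          exact ⟨Or.inr ⟨h1.2.ne', by tauto⟩, h1.2⟩
      by_cases ht : tog A
      · have h1 := card_filter_add_card_filter_not (s := B) (fun w => w ∈ A)
        have h2 := key {w ∈ B | w ∉ A} (filter_subset _ _) fun w hw => by
          have := (mem_filter.1 hw).2
          tauto
        have h3 : #{w ∈ B | w ∈ A} + 1 < q := ht
        omega
      · have h2 := key {w ∈ B | w ∈ A} (filter_subset _ _) fun w hw => by
          have := (mem_filter.1 hw).2
          tauto
        have h3 : ¬ (#{w ∈ B | w ∈ A} + 1 < q) := ht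
        omega
  have hcard : #(univ : Finset (Finset V)) ≤
      #(({A | y ∈ sel G A q H} : Finset (Finset V)) ×ˢ (univ : Finset (Bool × Bool × Bool))) := by
    refine card_le_card_of_injOn
      (fun A => (φ A, decide (y ∈ A), decide (z ∈ A), decide (tog A))) ?_ ?_
    · intro A _
      simpa using hgood A
    · intro A _ A' _ h
      simp only [Prod.mk.injEq, decide_eq_decide] at h
      obtain ⟨h1, h2, h3, h4⟩ := h
      ext w
      by_cases hwy : w = y
      · rw [hwy, h2]
      by_cases hwz : w = z
      · rw [hwz, h3]
      have h5 : w ∈ φ A ↔ w ∈ φ A' := by rw [h1]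
      rw [hφ, hφ, h4] at h5
      simp only [hwy, hwz, false_or, ne_eq, not_false_eq_true, true_and] at h5
      by_cases hc : w ∈ B ∧ tog A'
      · simpa [hc, not_iff_not] using h5
      · simpa only [hc, not_false_eq_true, iff_true] using h5
  rw [card_product] at hcard
  simp only [card_univ, Fintype.card_finset, Fintype.card_prod, Fintype.card_bool] at hcard
  omega

lemma sel_subset_leaves (A : Finset V) (q : ℕ) : sel G A q H ⊆ leaves H := fun y hy => by
  simpa [leaves] using (mem_sel.1 hy).2.1

lemma two_pow_le_card_sel_large (hHG : H ≤ G) (q : ℕ) (hq : ∀ y, 2 * q ≤ dg G y)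
    (hL : 0 < #(leaves H)) :
    2 ^ Fintype.card V ≤ 16 * #{A | #(leaves H) ≤ 16 * #(sel G A q H)} := by
  set L := #(leaves H)
  have h1 : L * 2 ^ Fintype.card V ≤ 8 * ∑ A, #(sel G A q H) := by
    have : ∑ A : Finset V, #(sel G A q H) = ∑ y ∈ leaves H, #{A | y ∈ sel G A q H} := by
      have e : ∀ A : Finset V, #(sel G A q H) = #{y ∈ leaves H | y ∈ sel G A q H} := fun A => by
        rw [filter_mem_eq_inter, inter_eq_right.2 (sel_subset_leaves A q)]
      simp_rw [e, card_filter]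
      exact sum_comm
    rw [this, mul_sum, ← smul_eq_mul]
    exact card_nsmul_le_sum _ _ _ fun y hy => two_pow_le_card_mem_sel hHG q (hq y) hy
  have h2 : ∀ A : Finset V, 16 * #(sel G A q H) ≤
      L + 16 * L * (if L ≤ 16 * #(sel G A q H) then 1 else 0) := by
    intro A
    have := card_le_card (sel_subset_leaves (H := H) (G := G) A q)
    split_ifs with h <;> omega
  have h3 := sum_le_sum fun A (_ : A ∈ (univ : Finset (Finset V))) => h2 A
  rw [← mul_sum, sum_add_distrib, ← mul_sum, sum_const, card_univ, Fintype.card_finset,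
    ← card_filter, smul_eq_mul] at h3
  have h4 : L * 2 ^ Fintype.card V ≤ L * (16 * #{A | L ≤ 16 * #(sel G A q H)}) := by
    nlinarith
  exact Nat.le_of_mul_le_mul_left h4 hL

theorem exists_card_iso_leaves_le (q : ℕ) (hq : 16 * 6400 ≤ q) :
    ∃ n₀ : ℕ, ∀ (V : Type) [Fintype V] (G : SimpleGraph V) (W : Type)
      (T : SimpleGraph W), n₀ ≤ Fintype.card V → (∀ y, 2 * q ≤ dg G y) →
      (#{H ∈ trees G | Nonempty (H ≃g T) ∧ Fintype.card V ≤ 400 * #(leaves H)} : ℝ) ≤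
        16 * (4 * (Fintype.card V : ℝ) ^ (-((q / (16 * 6400) : ℕ) / 34 : ℝ))) * #(trees G) := by
  obtain ⟨n₀, hn₀⟩ := exists_card_iso_sel_le 6400 q (by norm_num) hq
  refine ⟨n₀ + 1, fun V _ G W T hn hdeg => ?_⟩
  set β := 4 * (Fintype.card V : ℝ) ^ (-((q / (16 * 6400) : ℕ) / 34 : ℝ))
  set E := {H ∈ trees G | Nonempty (H ≃g T) ∧ Fintype.card V ≤ 400 * #(leaves H)} with hE
  have h1 : #E * 2 ^ Fintype.card V ≤
      16 * ∑ A : Finset V,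
        #{H ∈ trees G | Nonempty (H ≃g T) ∧ Fintype.card V ≤ 6400 * #(sel G A q H)} := by
    have h2 : ∀ H ∈ E, 2 ^ Fintype.card V ≤
        16 * #{A | Fintype.card V ≤ 6400 * #(sel G A q H)} := by
      intro H hH
      obtain ⟨hHt, -, hl⟩ := mem_filter.1 hH
      refine (two_pow_le_card_sel_large (mem_trees.1 hHt).1 q hdeg (by omega)).trans ?_
      refine Nat.mul_le_mul_left _ (card_le_card fun A hA => ?_)
      rw [mem_filter] at hA ⊢
      exact ⟨hA.1, by have := hA.2; omega⟩
    have h3 := card_nsmul_le_sum E _ _ h2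
    rw [smul_eq_mul, ← mul_sum] at h3
    refine h3.trans (Nat.mul_le_mul_left _ ?_)
    simp_rw [card_filter]
    rw [sum_comm]
    refine sum_le_sum fun A _ => ?_
    rw [hE, sum_filter]
    refine sum_le_sum fun H hH => ?_
    split_ifs <;> simp_all
  have h2 : (#E : ℝ) * 2 ^ Fintype.card V ≤ 16 * (2 ^ Fintype.card V * (β * #(trees G))) := by
    calc (#E : ℝ) * 2 ^ Fintype.card V ≤ ((16 * ∑ A : Finset V, #{H ∈ trees G | Nonempty (H ≃g T) ∧
          Fintype.card V ≤ 6400 * #(sel G A q H)} : ℕ) : ℝ) := by exact_mod_cast h1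
      _ = 16 * ∑ A : Finset V, (#{H ∈ trees G | Nonempty (H ≃g T) ∧
          Fintype.card V ≤ 6400 * #(sel G A q H)} : ℝ) := by push_cast; rfl
      _ ≤ 16 * ∑ A : Finset V, β * #(trees G) := by
          gcongr with A
          convert hn₀ V G A W T (by omega)
      _ = _ := by
          rw [sum_const, card_univ, Fintype.card_finset, nsmul_eq_mul]; push_cast; ring
  have h3 : (0 : ℝ) < 2 ^ Fintype.card V := by positivity
  refine le_of_mul_le_mul_right ?_ h3
  linarith

end Average

section Rotation
variable {V : Type*} {H : SimpleGraph V} {x y v : V}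

def rot (H : SimpleGraph V) (x y v : V) : SimpleGraph V :=
  (H \ SimpleGraph.edge x y) ⊔ SimpleGraph.edge x v

lemma rot_adj (hxy : H.Adj x y) (hxv : x ≠ v) {a b : V} : (rot H x y v).Adj a b ↔
    (H.Adj a b ∧ ¬ (x = a ∧ y = b ∨ x = b ∧ y = a)) ∨ (x = a ∧ v = b ∨ x = b ∧ v = a) := by
  have e : ∀ z w, (SimpleGraph.edge z w).Adj a b ↔ (z = a ∧ w = b ∨ z = b ∧ w = a) ∧ a ≠ b := by
    intro z w
    rw [SimpleGraph.edge_adj]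
    grind
  rw [rot, SimpleGraph.sup_adj, SimpleGraph.sdiff_adj, e, e]
  by_cases hab : a = b
  · subst hab
    simp only [SimpleGraph.irrefl, false_and, false_or, ne_eq, not_true_eq_false, and_false,
      false_iff, or_self]
    rintro ⟨rfl, rfl⟩
    exact hxv rfl
  · simp only [ne_eq, hab, not_false_eq_true, and_true]

lemma rot_rot (hxy : H.Adj x y) (hxv : x ≠ v) (hn : ¬ H.Adj x v) : rot (rot H x y v) x v y = H := by
  have h : (rot H x y v).Adj x v := (rot_adj hxy hxv).2 (Or.inr (Or.inl ⟨rfl, rfl⟩))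
  ext a b
  rw [rot_adj h hxy.ne, rot_adj hxy hxv]
  constructor
  · rintro (⟨⟨h, -⟩ | h, h'⟩ | ⟨rfl, rfl⟩ | ⟨rfl, rfl⟩)
    · exact h
    · exact absurd h h'
    · exact hxy
    · exact hxy.symm
  · intro h
    by_cases h1 : x = a ∧ y = b ∨ x = b ∧ y = a
    · exact Or.inr h1
    · refine Or.inl ⟨Or.inl ⟨h, h1⟩, ?_⟩
      rintro (⟨rfl, rfl⟩ | ⟨rfl, rfl⟩)
      · exact hn h
      · exact hn h.symm

lemma dg_rot [Fintype V] (hxy : H.Adj x y) (hxv : x ≠ v) (hn : ¬ H.Adj x v) (u : V) :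
    dg (rot H x y v) u + (if u = y then 1 else 0) = dg H u + if u = v then 1 else 0 := by
  have hyv : y ≠ v := fun h => hn (h ▸ hxy)
  have hyx := hxy.ne'
  by_cases hux : u = x
  · subst hux
    rw [if_neg hxy.ne, if_neg hxv, add_zero, add_zero, dg, dg]
    have : univ.filter (fun w => (rot H u y v).Adj u w) =
        insert v ((univ.filter fun w => H.Adj u w).erase y) := by
      ext w
      simp only [mem_filter, mem_univ, true_and, rot_adj hxy hxv, mem_insert, mem_erase]
      grind
    rw [this, card_insert_of_notMem (by simp [hn]), card_erase_add_one (by simpa using hxy)]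
  by_cases huy : u = y
  · subst huy
    rw [if_pos rfl, if_neg hyv, add_zero, dg, dg]
    have : univ.filter (fun w => (rot H x u v).Adj u w) =
        (univ.filter fun w => H.Adj u w).erase x := by
      ext w
      simp only [mem_filter, mem_univ, true_and, rot_adj hxy hxv, mem_erase]
      grind
    rw [this, card_erase_add_one (by simpa using hxy.symm)]
  by_cases huv : u = v
  · subst huv
    rw [if_pos rfl, if_neg huy, add_zero, dg, dg]
    have : univ.filter (fun w => (rot H x y u).Adj u w) =
        insert x (univ.filter fun w => H.Adj u w) := by
      ext w
      simp only [mem_filter, mem_univ, true_and, rot_adj hxy hxv, mem_insert]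
      grind
    rw [this, card_insert_of_notMem (by simpa [H.adj_comm] using hn)]
  · rw [if_neg huy, if_neg huv, add_zero, add_zero, dg, dg]
    congr 1
    ext w
    simp only [mem_filter, mem_univ, true_and, rot_adj hxy hxv]
    grind

/-- `y` is the neighbour of `x` through which `H` connects `x` to `v`. -/
def Toward (H : SimpleGraph V) (x v y : V) : Prop :=
  H.Adj x y ∧ ∃ p : H.Walk y v, x ∉ p.support

lemma exists_toward (hH : H.Connected) (hxv : x ≠ v) : ∃ y, Toward H x v y := by
  obtain ⟨p, hp⟩ := (hH.preconnected x v).exists_isPath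
  cases p with
  | nil => exact absurd rfl hxv
  | cons h p => exact ⟨_, h, p, ((SimpleGraph.Walk.cons_isPath_iff _ _).1 hp).2⟩

lemma Toward.unique (hH : H.IsAcyclic) {y' : V} (h : Toward H x v y) (h' : Toward H x v y') :
    y = y' := by
  obtain ⟨ha, p, hp⟩ := h
  obtain ⟨ha', p', hp'⟩ := h'
  have e := (hH.subsingleton_path x v).elim
    ⟨.cons ha p.bypass, (SimpleGraph.Walk.cons_isPath_iff _ _).2
      ⟨p.bypass_isPath, fun h => hp (p.support_bypass_subset_support h)⟩⟩
    ⟨.cons ha' p'.bypass, (SimpleGraph.Walk.cons_isPath_iff _ _).2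
      ⟨p'.bypass_isPath, fun h => hp' (p'.support_bypass_subset_support h)⟩⟩
  have e' := congrArg (fun q => q.1.snd) e
  simpa using e'

lemma Toward.exists_walk_rot (h : Toward H x v y) (hxv : x ≠ v) :
    ∃ p : (rot H x y v).Walk y v, x ∉ p.support := by
  obtain ⟨ha, p, hp⟩ := h
  have key : ∀ {b c : V} (p : H.Walk b c), x ∉ p.support →
      ∃ p' : (rot H x y v).Walk b c, x ∉ p'.support := by
    intro b c p hp
    induction p with
    | nil => exact ⟨.nil, by simpa using hp⟩
    | cons h p ih =>
      rw [SimpleGraph.Walk.support_cons, List.mem_cons, not_or] at hp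
      obtain ⟨p', hp'⟩ := ih hp.2
      refine ⟨.cons ((rot_adj ha hxv).2 (Or.inl ⟨h, ?_⟩)) p', ?_⟩
      · rintro (⟨h1, -⟩ | ⟨h1, -⟩)
        · exact hp.1 h1
        · exact hp.2 (h1 ▸ p.start_mem_support)
      · rw [SimpleGraph.Walk.support_cons, List.mem_cons, not_or]
        exact ⟨hp.1, hp'⟩
  exact key p hp

lemma Toward.rot (h : Toward H x v y) (hxv : x ≠ v) : Toward (rot H x y v) x y v := by
  obtain ⟨p, hp⟩ := h.exists_walk_rot hxv
  exact ⟨(rot_adj h.1 hxv).2 (Or.inr (Or.inl ⟨rfl, rfl⟩)), p.reverse, by simpa using hp⟩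

lemma Toward.isTree_rot [Fintype V] (h : Toward H x v y) (hxv : x ≠ v) (hn : ¬ H.Adj x v)
    (hH : H.IsTree) : (AntiTree.rot H x y v).IsTree := by
  refine isTree_of_sum_dg ?_ ?_
  · have h1 : ∀ a b, H.Adj a b → (AntiTree.rot H x y v).Reachable a b := by
      have hxy : (AntiTree.rot H x y v).Reachable x y := by
        obtain ⟨h2, p, -⟩ := h.rot hxv
        exact h2.reachable.trans p.reachable
      intro a b hab
      by_cases hc : x = a ∧ y = b ∨ x = b ∧ y = a
      · rcases hc with ⟨rfl, rfl⟩ | ⟨rfl, rfl⟩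
        · exact hxy
        · exact hxy.symm
      · exact ((rot_adj h.1 hxv).2 (Or.inl ⟨hab, hc⟩)).reachable
    have := hH.connected.nonempty
    refine SimpleGraph.Connected.mk fun a b => ?_
    obtain ⟨p⟩ := hH.connected.preconnected a b
    induction p with
    | nil => rfl
    | cons hadj _ ih => exact (h1 _ _ hadj).trans ih
  · have h1 := sum_congr rfl fun u (_ : u ∈ univ) => dg_rot h.1 hxv hn u
    rw [sum_add_distrib, sum_add_distrib, sum_ite_eq', sum_ite_eq', if_pos (mem_univ _),
      if_pos (mem_univ _)] at h1
    rw [← sum_dg_eq hH]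
    omega

end Rotation

section Switching
variable {V : Type} [Fintype V] {G H : SimpleGraph V}

noncomputable def wt (G : SimpleGraph V) (x : V) : ℝ := (dg G x : ℝ)⁻¹

noncomputable def pressure (G : SimpleGraph V) (y : V) : ℝ := ∑ x, if G.Adj x y then wt G x else 0

noncomputable def goodLeaves (G H : SimpleGraph V) : Finset V :=
  univ.filter fun y => dg H y = 1 ∧ pressure G y ≤ 12

lemma mem_goodLeaves {y : V} : y ∈ goodLeaves G H ↔ dg H y = 1 ∧ pressure G y ≤ 12 := by
  simp [goodLeaves]

noncomputable def treesWith (G : SimpleGraph V) (l : ℕ) : Finset (SimpleGraph V) :=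
  (trees G).filter fun H => #(goodLeaves G H) = l

noncomputable def nextVertex (H : SimpleGraph V) (x v : V) : V :=
  if h : ∃ y, Toward H x v y then h.choose else x

lemma toward_nextVertex (hH : H.Connected) {x v : V} (hxv : x ≠ v) :
    Toward H x v (nextVertex H x v) := by
  have h := exists_toward hH hxv
  rw [nextVertex, dif_pos h]
  exact h.choose_spec

def Switchable (G H : SimpleGraph V) (x v : V) : Prop :=
  G.Adj x v ∧ ¬ H.Adj x v ∧ (dg H (nextVertex H x v) = 2 ∧ pressure G (nextVertex H x v) ≤ 12) ∧
    v ∉ goodLeaves G H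

lemma wt_nonneg (x : V) : 0 ≤ wt G x := inv_nonneg.2 (Nat.cast_nonneg _)

lemma pressure_nonneg (y : V) : 0 ≤ pressure G y :=
  sum_nonneg fun x _ => by split_ifs; exacts [wt_nonneg x, le_rfl]

lemma sum_wt_adj (hG : ∀ x, 0 < dg G x) (x : V) : ∑ v, (if G.Adj x v then wt G x else 0) = 1 := by
  rw [← sum_filter, sum_const, nsmul_eq_mul, wt, ← dg]
  exact mul_inv_cancel₀ (by exact_mod_cast (hG x).ne')

lemma sum_pressure (hG : ∀ x, 0 < dg G x) : ∑ y, pressure G y = Fintype.card V := by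
  simp_rw [pressure]
  rw [sum_comm]
  simp_rw [sum_wt_adj hG]
  simp

lemma card_pressure_gt (hG : ∀ x, 0 < dg G x) :
    12 * (#{y | ¬ pressure G y ≤ 12} : ℝ) ≤ Fintype.card V := by
  rw [← sum_pressure hG, card_filter, mul_comm]
  push_cast
  rw [sum_mul]
  refine sum_le_sum fun y _ => ?_
  have := pressure_nonneg (G := G) y
  split_ifs with h <;> linarith

lemma sum_dg_bad_le (hG : ∀ x, 0 < dg G x) (hH : H.IsTree) (hpos : ∀ y, 0 < dg H y) :
    ∑ y, (if dg H y = 2 ∧ pressure G y ≤ 12 then (0 : ℝ) else dg H y) ≤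
      4 * #(goodLeaves G H) + Fintype.card V / 2 := by
  have h1 : ∀ y, (if dg H y = 2 ∧ pressure G y ≤ 12 then (0 : ℝ) else dg H y) ≤
      3 * ((dg H y : ℝ) - 2) + 4 * (if dg H y = 1 ∧ pressure G y ≤ 12 then 1 else 0) +
        6 * (if ¬ pressure G y ≤ 12 then 1 else 0) := by
    intro y
    have h0 := hpos y
    by_cases hp : pressure G y ≤ 12
    · simp only [hp, and_true, not_true_eq_false, if_false]
      rcases (by omega : dg H y = 1 ∨ dg H y = 2 ∨ 3 ≤ dg H y) with h | h | h
      · simp [h]; norm_num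
      · simp [h]
      · rw [if_neg (by omega), if_neg (by omega)]
        have : (3 : ℝ) ≤ dg H y := by exact_mod_cast h
        linarith
    · simp only [hp, and_false, if_false, not_false_eq_true, if_true]
      have : (1 : ℝ) ≤ dg H y := by exact_mod_cast h0
      linarith
  have h2 := sum_le_sum fun y (_ : y ∈ univ) => h1 y
  rw [sum_add_distrib, sum_add_distrib, ← mul_sum, ← mul_sum, ← mul_sum, sum_sub_distrib,
    sum_boole, sum_boole] at h2
  have h3 : (∑ y, (dg H y : ℝ)) + 2 = 2 * Fintype.card V := by exact_mod_cast sum_dg_eq hH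
  have h4 := card_pressure_gt hG
  have h5 : (#(goodLeaves G H) : ℝ) = #{y | dg H y = 1 ∧ pressure G y ≤ 12} := rfl
  simp only [sum_const, card_univ, nsmul_eq_mul] at h2
  linarith

lemma le_sum_switchable (d : ℕ) (hd : 0 < d) (hG : ∀ x, d ≤ dg G x) (hH : H ∈ trees G)
    (hpos : ∀ y, 0 < dg H y) : (Fintype.card V : ℝ) / 2 - 2 * Fintype.card V / d -
      16 * #(goodLeaves G H) ≤ ∑ x, ∑ v, if Switchable G H x v then wt G x else 0 := by
  obtain ⟨hHG, hT⟩ := mem_trees.1 hH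
  have hG0 : ∀ x, 0 < dg G x := fun x => hd.trans_le (hG x)
  let bad : V → Prop := fun y => ¬ (dg H y = 2 ∧ pressure G y ≤ 12)
  have hpt : ∀ x v, (if G.Adj x v then wt G x else 0) ≤
      (if H.Adj x v then wt G x else 0) + (if Switchable G H x v then wt G x else 0) +
      (if v ∈ goodLeaves G H then if G.Adj x v then wt G x else 0 else 0) +
      ∑ y, if bad y ∧ H.Adj x y then if G.Adj x v then wt G x else 0 else 0 := by
    intro x v
    have hw := wt_nonneg (G := G) x
    by_cases hGa : G.Adj x v
    swap
    · simp only [hGa, if_false, ite_self, sum_const_zero]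
      have : 0 ≤ if H.Adj x v then wt G x else 0 := by split_ifs <;> simp [hw]
      have : 0 ≤ if Switchable G H x v then wt G x else 0 := by split_ifs <;> simp [hw]
      linarith
    simp only [hGa, if_true]
    have n1 : 0 ≤ if H.Adj x v then wt G x else 0 := by split_ifs <;> simp [hw]
    have n2 : 0 ≤ if Switchable G H x v then wt G x else 0 := by split_ifs <;> simp [hw]
    have n3 : 0 ≤ if v ∈ goodLeaves G H then wt G x else 0 := by split_ifs <;> simp [hw]
    have n4 : ∀ y ∈ univ, 0 ≤ if bad y ∧ H.Adj x y then wt G x else 0 := fun y _ => by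
      split_ifs <;> simp [hw]
    by_cases hHa : H.Adj x v
    · have := sum_nonneg n4
      rw [if_pos hHa] at n1 ⊢
      linarith
    by_cases hv : v ∈ goodLeaves G H
    · have := sum_nonneg n4
      rw [if_pos hv] at n3 ⊢
      linarith
    by_cases hb : bad (nextVertex H x v)
    · have := single_le_sum n4 (mem_univ (nextVertex H x v))
      rw [if_pos ⟨hb, (toward_nextVertex hT.connected hGa.ne).1⟩] at this
      linarith
    · have := sum_nonneg n4
      rw [if_pos (show Switchable G H x v from ⟨hGa, hHa, not_not.1 hb, hv⟩)] at n2 ⊢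
      linarith
  have h1 := sum_le_sum fun x (_ : x ∈ univ) => sum_le_sum fun v (_ : v ∈ univ) => hpt x v
  simp only [sum_add_distrib, sum_wt_adj hG0] at h1
  have e1 : ∑ x, ∑ v, (if H.Adj x v then wt G x else 0) ≤ 2 * Fintype.card V / d := by
    have : ∀ x, ∑ v, (if H.Adj x v then wt G x else 0) ≤ dg H x / d := by
      intro x
      rw [← sum_filter, sum_const, nsmul_eq_mul, wt, ← dg, div_eq_mul_inv]
      have hd' : (0 : ℝ) < d := by exact_mod_cast hd
      have := hG x
      gcongr
    refine (sum_le_sum fun x _ => this x).trans ?_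
    rw [← sum_div]
    have h3 : (∑ y, (dg H y : ℝ)) + 2 = 2 * Fintype.card V := by exact_mod_cast sum_dg_eq hT
    gcongr
    linarith
  have e2 : ∑ x, ∑ v, (if v ∈ goodLeaves G H then if G.Adj x v then wt G x else 0 else 0) ≤
      12 * #(goodLeaves G H) := by
    rw [sum_comm]
    have : ∀ v, ∑ x, (if v ∈ goodLeaves G H then if G.Adj x v then wt G x else 0 else 0) ≤
        12 * if v ∈ goodLeaves G H then 1 else 0 := by
      intro v
      by_cases hv : v ∈ goodLeaves G H
      · simp only [hv, if_true, mul_one]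
        exact (mem_goodLeaves.1 hv).2
      · simp [hv]
    refine (sum_le_sum fun v _ => this v).trans ?_
    rw [← mul_sum, sum_boole]
    simp
  have e3 : ∑ x, ∑ v, ∑ y, (if bad y ∧ H.Adj x y then if G.Adj x v then wt G x else 0 else 0) ≤
      4 * #(goodLeaves G H) + Fintype.card V / 2 := by
    refine le_trans (le_of_eq ?_) (sum_dg_bad_le hG0 hT hpos)
    calc _ = ∑ x, ∑ y, ∑ v, (if bad y ∧ H.Adj x y then if G.Adj x v then wt G x else 0 else 0) :=
          sum_congr rfl fun x _ => sum_comm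
      _ = ∑ x, ∑ y, if bad y ∧ H.Adj x y then 1 else 0 := by
          refine sum_congr rfl fun x _ => sum_congr rfl fun y _ => ?_
          split_ifs
          · exact sum_wt_adj hG0 x
          · simp
      _ = ∑ y, ∑ x, if bad y ∧ H.Adj x y then 1 else 0 := sum_comm
      _ = _ := by
          refine sum_congr rfl fun y _ => ?_
          by_cases hb : dg H y = 2 ∧ pressure G y ≤ 12
          · simp [bad, hb]
          · simp only [bad, hb, not_false_eq_true, true_and, if_false]
            rw [sum_boole, dg]
            simp only [H.adj_comm]
  simp only [sum_const, card_univ, nsmul_eq_mul, mul_one] at h1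
  linarith

end Switching

section Abundance
variable {V : Type} [Fintype V] {G H : SimpleGraph V}

lemma mem_treesWith {l : ℕ} : H ∈ treesWith G l ↔ (H ≤ G ∧ H.IsTree) ∧ #(goodLeaves G H) = l := by
  rw [treesWith, mem_filter, mem_trees]

lemma rot_mem_treesWith {l : ℕ} (hH : H ∈ treesWith G l) {x v : V} (hs : Switchable G H x v)
    (hpos : ∀ y, 0 < dg H y) :
    rot H x (nextVertex H x v) v ∈ treesWith G (l + 1) ∧
      nextVertex H x v ∈ goodLeaves G (rot H x (nextVertex H x v) v) := by
  obtain ⟨⟨hHG, hT⟩, hl⟩ := mem_treesWith.1 hH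
  obtain ⟨hGa, hHa, ⟨hd2, hp⟩, hv⟩ := hs
  have hto := toward_nextVertex hT.connected hGa.ne
  set y := nextVertex H x v
  have hdg := dg_rot hto.1 hGa.ne hHa
  have hyv : y ≠ v := fun h => hHa (h ▸ hto.1)
  have hy1 : dg (rot H x y v) y = 1 := by
    have := hdg y
    rw [if_pos rfl, if_neg hyv] at this
    omega
  have hv2 : dg (rot H x y v) v ≠ 1 := by
    have := hdg v
    rw [if_pos rfl, if_neg hyv.symm] at this
    have := hpos v
    omega
  have hleaf : goodLeaves G (rot H x y v) = insert y (goodLeaves G H) := by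
    ext u
    rw [mem_insert, mem_goodLeaves, mem_goodLeaves]
    by_cases huy : u = y
    · subst huy
      simp [hy1, hp]
    by_cases huv : u = v
    · subst huv
      rw [mem_goodLeaves] at hv
      simp [hv2, huy, hv]
    · have := hdg u
      rw [if_neg huy, if_neg huv, add_zero, add_zero] at this
      simp [this, huy]
  have hyn : y ∉ goodLeaves G H := fun h => by
    have := (mem_goodLeaves.1 h).1
    omega
  refine ⟨mem_treesWith.2 ⟨⟨?_, hto.isTree_rot hGa.ne hHa hT⟩, ?_⟩, ?_⟩
  · intro a b hab
    rcases (rot_adj hto.1 hGa.ne).1 hab with h | ⟨rfl, rfl⟩ | ⟨rfl, rfl⟩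
    · exact hHG h.1
    · exact hGa
    · exact hGa.symm
  · rw [hleaf, card_insert_of_notMem hyn, hl]
  · rw [hleaf]
    exact mem_insert_self _ _

lemma sum_switchable_le (l : ℕ) (hpos : ∀ H ∈ trees G, ∀ y, 0 < dg H y) :
    ∑ H ∈ treesWith G l, ∑ x, ∑ v, (if Switchable G H x v then wt G x else 0) ≤
      #(treesWith G (l + 1)) * (12 * (l + 1)) := by
  let src : Finset (SimpleGraph V × V × V) :=
    {t ∈ treesWith G l ×ˢ univ | Switchable G t.1 t.2.1 t.2.2}
  let tgt : Finset (SimpleGraph V × V × V) :=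
    {t ∈ treesWith G (l + 1) ×ˢ univ | t.2.2 ∈ goodLeaves G t.1 ∧ G.Adj t.2.1 t.2.2}
  let f : SimpleGraph V × V × V → SimpleGraph V × V × V := fun t =>
    (rot t.1 t.2.1 (nextVertex t.1 t.2.1 t.2.2) t.2.2, t.2.1, nextVertex t.1 t.2.1 t.2.2)
  have hsrc : ∀ t ∈ src, t.1 ∈ treesWith G l ∧ Switchable G t.1 t.2.1 t.2.2 := fun t ht => by
    simpa [src] using ht
  have htr : ∀ {H : SimpleGraph V} {l}, H ∈ treesWith G l → H ∈ trees G := fun h =>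
    (mem_filter.1 h).1
  have hmaps : ∀ t ∈ src, f t ∈ tgt := by
    intro t ht
    obtain ⟨h1, h2⟩ := hsrc t ht
    obtain ⟨h3, h4⟩ := rot_mem_treesWith h1 h2 (hpos _ (htr h1))
    obtain ⟨⟨hHG, hT⟩, -⟩ := mem_treesWith.1 h1
    simp only [tgt, mem_filter, mem_product, mem_univ, and_true, f]
    exact ⟨h3, h4, hHG (toward_nextVertex hT.connected h2.1.ne).1⟩
  have hinj : Set.InjOn f src := by
    rintro ⟨H, x, v⟩ ht ⟨H', x', v'⟩ ht' heq
    obtain ⟨h1, h2⟩ := hsrc _ ht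
    obtain ⟨h1', h2'⟩ := hsrc _ ht'
    simp only [f, Prod.mk.injEq] at heq h1 h2 h1' h2'
    obtain ⟨e1, rfl, e2⟩ := heq
    obtain ⟨⟨-, hT⟩, -⟩ := mem_treesWith.1 h1
    obtain ⟨⟨-, hT'⟩, -⟩ := mem_treesWith.1 h1'
    have t1 := toward_nextVertex hT.connected h2.1.ne
    have t2 := toward_nextVertex hT'.connected h2'.1.ne
    have hTr := t1.isTree_rot h2.1.ne h2.2.1 hT
    have r1 := t1.rot h2.1.ne
    have r2 := t2.rot h2'.1.ne
    rw [← e1, ← e2] at r2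
    obtain rfl := r1.unique hTr.isAcyclic r2
    have k1 := rot_rot t1.1 h2.1.ne h2.2.1
    have k2 := rot_rot t2.1 h2'.1.ne h2'.2.1
    rw [← e1, ← e2, k1] at k2
    rw [k2]
  have hs : ∑ H ∈ treesWith G l, ∑ x, ∑ v, (if Switchable G H x v then wt G x else 0) =
      ∑ t ∈ src, wt G t.2.1 := by
    rw [sum_filter, sum_product]
    refine sum_congr rfl fun H _ => ?_
    rw [← univ_product_univ, sum_product]
  have ht : ∑ t ∈ tgt, wt G t.2.1 ≤ #(treesWith G (l + 1)) * (12 * (l + 1)) := by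
    rw [sum_filter, sum_product, ← nsmul_eq_mul]
    refine sum_le_card_nsmul _ _ _ fun H hH => ?_
    rw [← univ_product_univ, sum_product, sum_comm]
    have : ∀ y, ∑ x, (if y ∈ goodLeaves G H ∧ G.Adj x y then wt G x else 0) ≤
        if y ∈ goodLeaves G H then 12 else 0 := by
      intro y
      by_cases hy : y ∈ goodLeaves G H
      · simp only [hy, true_and, if_true]
        exact (mem_goodLeaves.1 hy).2
      · simp [hy]
    refine (sum_le_sum fun y _ => this y).trans (le_of_eq ?_)
    rw [← sum_filter, sum_const, nsmul_eq_mul, filter_mem_eq_inter, univ_inter,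
      (mem_treesWith.1 hH).2]
    push_cast; ring
  rw [hs]
  refine le_trans ?_ ht
  calc ∑ t ∈ src, wt G t.2.1 = ∑ t ∈ src.image f, wt G t.2.1 := by
        rw [sum_image hinj]
    _ ≤ _ := sum_le_sum_of_subset_of_nonneg
        (fun t ht => by obtain ⟨s, hs, rfl⟩ := mem_image.1 ht; exact hmaps s hs)
        fun t _ _ => wt_nonneg _

lemma dg_pos_of_connected [Nontrivial V] (hH : H.Connected) (y : V) : 0 < dg H y := by
  obtain ⟨x, hx⟩ := exists_ne y
  obtain ⟨z, hz, -⟩ := exists_toward hH hx.symm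
  exact card_pos.2 ⟨z, by simpa using hz⟩

lemma two_mul_card_treesWith_le (hV : 200 ≤ Fintype.card V) (hG : ∀ x, 16 ≤ dg G x) (l : ℕ)
    (hl : 200 * l ≤ Fintype.card V) : 2 * #(treesWith G l) ≤ #(treesWith G (l + 1)) := by
  have : Nontrivial V := Fintype.one_lt_card_iff_nontrivial.1 (by omega)
  have hpos : ∀ H ∈ trees G, ∀ y, 0 < dg H y := fun H hH =>
    dg_pos_of_connected (mem_trees.1 hH).2.connected
  have h1 := sum_switchable_le l hpos
  have h2 : (#(treesWith G l) : ℝ) * ((Fintype.card V : ℝ) / 2 - 2 * Fintype.card V / (16 : ℕ) -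
      16 * l) ≤ ∑ H ∈ treesWith G l, ∑ x, ∑ v, (if Switchable G H x v then wt G x else 0) := by
    rw [← nsmul_eq_mul]
    refine card_nsmul_le_sum _ _ _ fun H hH => ?_
    have hHt := (mem_filter.1 hH).1
    have := le_sum_switchable 16 (by norm_num) hG hHt (hpos H hHt)
    rwa [(mem_filter.1 hH).2] at this
  have hVR : (200 : ℝ) ≤ Fintype.card V := by exact_mod_cast hV
  have hlR : 200 * (l : ℝ) ≤ Fintype.card V := by exact_mod_cast hl
  have h3 : (#(treesWith G l) : ℝ) * (24 * (l + 1)) ≤ #(treesWith G (l + 1)) * (12 * (l + 1)) := by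
    refine le_trans ?_ (h2.trans h1)
    gcongr
    push_cast
    linarith
  have h4 : (2 * (#(treesWith G l) : ℝ)) * (12 * (l + 1)) ≤
      #(treesWith G (l + 1)) * (12 * (l + 1)) := by
    linarith
  have h5 := le_of_mul_le_mul_right h4 (by positivity)
  exact_mod_cast h5

theorem card_few_leaves_le (hV : 200 ≤ Fintype.card V) (hG : ∀ x, 16 ≤ dg G x) :
    2 ^ (Fintype.card V / 400) * #{H ∈ trees G | ¬ Fintype.card V ≤ 400 * #(leaves H)} ≤
      #(trees G) := by
  set m := Fintype.card V / 400 with hm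
  have h1 : ∀ i j, j + i ≤ 2 * m → 2 ^ i * #(treesWith G j) ≤ #(treesWith G (j + i)) := by
    intro i
    induction i with
    | zero => simp
    | succ i ih =>
      intro j hj
      have h2 := ih j (by omega)
      have h3 := two_mul_card_treesWith_le hV hG (j + i) (by omega)
      rw [pow_succ, ← add_assoc]
      linarith
  have h2 : #{H ∈ trees G | ¬ Fintype.card V ≤ 400 * #(leaves H)} ≤
      ∑ j ∈ range (m + 1), #(treesWith G j) := by
    rw [← card_biUnion]
    · refine card_le_card fun H hH => ?_
      obtain ⟨hHt, hH⟩ := mem_filter.1 hH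
      have h3 : #(goodLeaves G H) ≤ #(leaves H) := card_le_card fun y hy => by
        simpa [leaves] using (mem_goodLeaves.1 hy).1
      rw [mem_biUnion]
      exact ⟨_, mem_range.2 (by omega), mem_filter.2 ⟨hHt, rfl⟩⟩
    · intro i _ j _ hij
      refine disjoint_filter.2 fun H _ h h' => hij (h.symm.trans h')
  calc _ ≤ 2 ^ m * ∑ j ∈ range (m + 1), #(treesWith G j) := Nat.mul_le_mul_left _ h2
    _ = ∑ j ∈ range (m + 1), 2 ^ m * #(treesWith G j) := mul_sum _ _ _
    _ ≤ ∑ j ∈ range (m + 1), #(treesWith G (j + m)) := sum_le_sum fun j hj =>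
        h1 m j (by have := mem_range.1 hj; omega)
    _ = #((range (m + 1)).biUnion fun j => treesWith G (j + m)) := by
        rw [card_biUnion]
        intro i _ j _ hij
        exact disjoint_filter.2 fun H _ h h' => hij (by omega)
    _ ≤ _ := card_le_card fun H hH => by
        obtain ⟨j, -, hj⟩ := mem_biUnion.1 hH
        exact (mem_filter.1 hj).1

end Abundance

/-! ### Conclusion -/

lemma half_pow_div_le_exp (n k : ℕ) (hk : 0 < k) :
    ((1 : ℝ) / 2) ^ (n / k) ≤ 2 * Real.exp (-(Real.log 2 / k) * n) := by
  have hlog : 0 < Real.log 2 := Real.log_pos (by norm_num)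
  have h1 : ((1 : ℝ) / 2) ^ (n / k) = Real.exp (-(Real.log 2) * (n / k : ℕ)) := by
    rw [Real.exp_mul, Real.exp_neg, Real.exp_log two_pos, Real.rpow_natCast]
    norm_num
  have h2 : (2 : ℝ) * Real.exp (-(Real.log 2 / k) * n) =
      Real.exp (Real.log 2 + -(Real.log 2 / k) * n) := by
    rw [Real.exp_add, Real.exp_log two_pos]
  rw [h1, h2, Real.exp_le_exp]
  have h3 : (n : ℝ) / k ≤ (n / k : ℕ) + 1 := by
    have hk' : (0 : ℝ) < k := by exact_mod_cast hk
    rw [div_le_iff₀ hk']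
    have : n ≤ (n / k + 1) * k := by
      have h := Nat.div_add_mod n k
      have h' := Nat.mod_lt n hk
      nlinarith
    exact_mod_cast this
  have h4 : Real.log 2 / k * n = Real.log 2 * (n / k) := by ring
  nlinarith

lemma exists_rpow_bound {a b : ℝ} (hab : b < a) (C : ℝ) :
    ∃ n₀ : ℕ, ∀ n : ℕ, n₀ ≤ n → C * (n : ℝ) ^ (-a) + (1 / 2) ^ (n / 400) ≤ (n : ℝ) ^ (-b) := by
  have hlog : 0 < Real.log 2 / (400 : ℕ) := div_pos (Real.log_pos (by norm_num)) (by norm_num)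
  have h1 := (tendsto_rpow_neg_atTop (sub_pos.2 hab)).const_mul C
  have h2 := (tendsto_rpow_mul_exp_neg_mul_atTop_nhds_zero b _ hlog).const_mul 2
  have h3 := (h1.add h2).comp tendsto_natCast_atTop_atTop
  obtain ⟨n₀, hn⟩ := Filter.eventually_atTop.1
    ((h3.eventually_le_const (u := 1) (by norm_num)).and (Filter.eventually_gt_atTop 0))
  refine ⟨n₀, fun n h => ?_⟩
  obtain ⟨h5, h6⟩ := hn n h
  have hn0 : (0 : ℝ) < n := by exact_mod_cast h6
  simp only [Function.comp_apply] at h5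
  have h7 := half_pow_div_le_exp n 400 (by norm_num)
  have h8 := mul_le_mul_of_nonneg_left h5 (Real.rpow_nonneg hn0.le (-b))
  have h9 : (n : ℝ) ^ (-b) * (n : ℝ) ^ (-(a - b)) = (n : ℝ) ^ (-a) := by
    rw [← Real.rpow_add hn0]
    ring_nf
  have h10 : (n : ℝ) ^ (-b) * (n : ℝ) ^ b = 1 := by
    rw [← Real.rpow_add hn0]
    simp
  rw [mul_one] at h8
  refine le_trans (le_trans (add_le_add_right h7 _) (le_of_eq ?_)) h8
  linear_combination -(C * h9) - 2 * Real.exp (-(Real.log 2 / (400 : ℕ)) * n) * h10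

lemma exists_card_iso_le (d : ℕ) (hd : 204800 ≤ d) : ∃ n₀ : ℕ,
    ∀ (V : Type) [Fintype V] (G : SimpleGraph V), n₀ ≤ Fintype.card V → (∀ y, d ≤ dg G y) →
      ∀ (W : Type) (T : SimpleGraph W),
        (#{H ∈ trees G | Nonempty (H ≃g T)} : ℝ) ≤
          (Fintype.card V : ℝ) ^ (-(1 / 10 ^ 8 * d : ℝ)) * #(trees G) := by
  obtain ⟨n₁, h₁⟩ := exists_card_iso_leaves_le (d / 2) (by omega)
  have hab : (1 / 10 ^ 8 * d : ℝ) < ((d / 2 / (16 * 6400) : ℕ) / 34 : ℝ) := by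
    have h : d ≤ 409600 * (d / 2 / (16 * 6400)) := by omega
    have h' : (d : ℝ) ≤ 409600 * ((d / 2 / (16 * 6400) : ℕ) : ℝ) := by exact_mod_cast h
    have h0 : (204800 : ℝ) ≤ d := by exact_mod_cast hd
    linarith
  obtain ⟨n₂, h₂⟩ := exists_rpow_bound hab 64
  refine ⟨max 200 (max n₁ n₂), fun V _ G hV hG W T => ?_⟩
  have hiso := h₁ V G W T (by omega) fun y => by have := hG y; omega
  have hfew := card_few_leaves_le (G := G) (by omega) fun y => by have := hG y; omega
  have hsplit : #{H ∈ trees G | Nonempty (H ≃g T)} ≤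
      #{H ∈ trees G | Nonempty (H ≃g T) ∧ Fintype.card V ≤ 400 * #(leaves H)} +
        #{H ∈ trees G | ¬ Fintype.card V ≤ 400 * #(leaves H)} := by
    refine (card_le_card fun H hH => ?_).trans (card_union_le _ _)
    simp only [mem_union, mem_filter] at hH ⊢
    tauto
  have hfew' : (#{H ∈ trees G | ¬ Fintype.card V ≤ 400 * #(leaves H)} : ℝ) ≤
      (1 / 2) ^ (Fintype.card V / 400) * #(trees G) := by
    rw [one_div, inv_pow, inv_mul_eq_div, le_div_iff₀ (by positivity), mul_comm]
    exact_mod_cast hfew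
  have hn := mul_le_mul_of_nonneg_right (h₂ (Fintype.card V) (by omega))
    (Nat.cast_nonneg (α := ℝ) #(trees G))
  refine le_trans ?_ hn
  have hsplit' : (#{H ∈ trees G | Nonempty (H ≃g T)} : ℝ) ≤
      #{H ∈ trees G | Nonempty (H ≃g T) ∧ Fintype.card V ≤ 400 * #(leaves H)} +
        #{H ∈ trees G | ¬ Fintype.card V ≤ 400 * #(leaves H)} := by exact_mod_cast hsplit
  linarith

theorem exists_ratio_le (d : ℕ) (hd : 204800 ≤ d) : ∃ n₀ : ℕ,
    ∀ (V : Type) [Fintype V] (G : SimpleGraph V), n₀ ≤ Fintype.card V → (∀ y, d ≤ dg G y) →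
      ∀ (W : Type) (T : SimpleGraph W),
        ({H : SimpleGraph V | H ≤ G ∧ H.IsTree ∧ Nonempty (H ≃g T)}.ncard : ℝ) /
            ({H : SimpleGraph V | H ≤ G ∧ H.IsTree}.ncard : ℝ) ≤
          (Fintype.card V : ℝ) ^ (-(1 / 10 ^ 8 * d : ℝ)) := by
  obtain ⟨n₀, h⟩ := exists_card_iso_le d hd
  refine ⟨n₀, fun V _ G hV hG W T => ?_⟩
  have h1 : {H : SimpleGraph V | H ≤ G ∧ H.IsTree ∧ Nonempty (H ≃g T)} =
      (({H ∈ trees G | Nonempty (H ≃g T)} : Finset (SimpleGraph V)) : Set (SimpleGraph V)) := by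
    ext H
    simp [mem_trees, and_assoc]
  have h2 : {H : SimpleGraph V | H ≤ G ∧ H.IsTree} = (trees G : Set (SimpleGraph V)) := by
    ext H
    simp [mem_trees]
  rw [h1, h2, Set.ncard_coe_finset, Set.ncard_coe_finset]
  exact div_le_of_le_mul₀ (by positivity) (by positivity) (h V G hV hG W T)

end AntiTree

/-- **Anticoncentration for random spanning trees in graphs of large minimum degree.**
There exist constants `c > 0` and `d₀` such that for every `d ≥ d₀` and every `n`
sufficiently large relative to `d`: if `G` is a connected graph with `n` vertices and
minimum degree at least `d`, and `𝒯` is a uniformly random spanning tree of `G`, then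
for every tree `T` we have `ℙ(𝒯 ≅ T) ≤ n^{-c·d}`. The probability is expressed as the
ratio of the number of spanning trees of `G` isomorphic to `T` to the total number of
spanning trees of `G`. -/
theorem anticoncentration_random_spanning_tree :
    ∃ (c : ℝ) (d₀ : ℕ), 0 < c ∧
      ∀ d : ℕ, d₀ ≤ d → ∃ n₀ : ℕ,
        ∀ (V : Type) [Fintype V] [DecidableEq V] (G : SimpleGraph V) [DecidableRel G.Adj],
          n₀ ≤ Fintype.card V → G.Connected → (∀ v : V, d ≤ G.degree v) →
          ∀ (W : Type) (T : SimpleGraph W), T.IsTree →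
            ({H : SimpleGraph V | H ≤ G ∧ H.IsTree ∧ Nonempty (H ≃g T)}.ncard : ℝ) /
                ({H : SimpleGraph V | H ≤ G ∧ H.IsTree}.ncard : ℝ) ≤
              (Fintype.card V : ℝ) ^ (-(c * d)) := by
  refine ⟨1 / 10 ^ 8, 204800, by norm_num, fun d hd => ?_⟩
  obtain ⟨n₀, h⟩ := AntiTree.exists_ratio_le d hd
  refine ⟨n₀, fun V _ _ G _ hV _ hG W T _ => h V G hV (fun y => ?_) W T⟩
  rw [AntiTree.dg_eq_degree]
  exact hG y
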